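/- arXiv:2111.01062 — 2 statements merged into one kernel-verified Lean document; each statement's English description precedes it below -/
import Mathlib

section
/- Let d≥3 and let V:ℤ^d→ℂ be Γ-periodic. Then for every λ∈ℂ, the Laurent polynomial z↦𝒫_V(z,λ) in the variables z_1,…,z_d is irreducible. -/
noncomputable section

/-- The discrete Laplacian on `ℤ^d`: `(Δu)(n) = Σ_{‖n'-n‖₁ = 1} u(n')`. -/
def discLap {d : ℕ} (u : (Fin d → ℤ) → ℂ) (n : Fin d → ℤ) : ℂ :=
  ∑ j : Fin d, (u (Function.update n j (n j + 1)) + u (Function.update n j (n j - 1)))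

/-- Reduction of an integer modulo `q`, as an element of `Fin q`. -/
def fem (q : ℕ+) (a : ℤ) : Fin (q : ℕ) :=
  ⟨(a % ((q : ℕ) : ℤ)).toNat, by
    have hq : (0:ℤ) < ((q : ℕ) : ℤ) := by exact_mod_cast q.pos
    have h1 : 0 ≤ a % ((q : ℕ) : ℤ) := Int.emod_nonneg a (ne_of_gt hq)
    have h2 : a % ((q : ℕ) : ℤ) < ((q : ℕ) : ℤ) := Int.emod_lt_of_pos a hq
    omega⟩

/-- Extension of a function on the fundamental domain `W` to `ℤ^d` using the
Floquet boundary conditions `u(n + qⱼ eⱼ) = zⱼ u(n)`. -/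
def extendBC {d : ℕ} (q : Fin d → ℕ+) (z : Fin d → ℂ)
    (u : (∀ j, Fin ((q j : ℕ))) → ℂ) : (Fin d → ℤ) → ℂ :=
  fun n => (∏ j, z j ^ (n j / ((q j : ℕ) : ℤ))) * u (fun j => fem (q j) (n j))

/-- The matrix `D_V(z)` of the Floquet reduction of `-Δ + V` to the fundamental domain. -/
def DVmat {d : ℕ} (q : Fin d → ℕ+) (V : (Fin d → ℤ) → ℂ) (z : Fin d → ℂ) :
    Matrix (∀ j, Fin ((q j : ℕ))) (∀ j, Fin ((q j : ℕ))) ℂ :=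
  fun n n' =>
    -(discLap (extendBC q z (Pi.single n' 1)) (fun j => ((n j : ℕ) : ℤ)))
      + V (fun j => ((n j : ℕ) : ℤ)) * (if n = n' then 1 else 0)

/-- `𝒫_V(z, λ) = det(D_V(z) - λ I)`. -/
def scriptP {d : ℕ} (q : Fin d → ℕ+) (V : (Fin d → ℤ) → ℂ) (z : Fin d → ℂ)
    (lam : ℂ) : ℂ :=
  Matrix.det (DVmat q V z - lam • (1 : Matrix (∀ j, Fin ((q j : ℕ))) (∀ j, Fin ((q j : ℕ))) ℂ))

/-- `Γ`-periodicity for a complex-valued function on `ℤ^d`. -/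
def IsPeriodic {d : ℕ} (q : Fin d → ℕ+) (V : (Fin d → ℤ) → ℂ) : Prop :=
  ∀ (n : Fin d → ℤ) (j : Fin d), V (Function.update n j (n j + ((q j : ℕ) : ℤ))) = V n

/-- `Γ`-periodicity for a real-valued function on `ℤ^d`. -/
def IsPeriodicR {d : ℕ} (q : Fin d → ℕ+) (V : (Fin d → ℤ) → ℝ) : Prop :=
  ∀ (n : Fin d → ℤ) (j : Fin d), V (Function.update n j (n j + ((q j : ℕ) : ℤ))) = V n

/-- `ρ_m = e^{2πi m / q}`. -/
def rho (q : ℕ+) (m : ℕ) : ℂ :=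
  Complex.exp (2 * (Real.pi : ℂ) * Complex.I * (m : ℂ) / ((q : ℕ) : ℂ))

/-- The discrete Fourier transform `V̂(l)` of a periodic potential. -/
def dft {d : ℕ} (q : Fin d → ℕ+) (V : (Fin d → ℤ) → ℂ) (l : Fin d → ℤ) : ℂ :=
  (1 / ((∏ j, (q j : ℕ) : ℕ) : ℂ)) * ∑ n : (∀ j, Fin ((q j : ℕ))),
    V (fun j => ((n j : ℕ) : ℤ)) *
      Complex.exp (-(2 * (Real.pi : ℂ) * Complex.I) * ∑ j, (l j : ℂ) * ((n j : ℕ) : ℂ) / ((q j : ℕ) : ℂ))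

/-- The diagonal matrix `A(z)` with entries `-Σⱼ (ρʲ_{nⱼ} zⱼ + 1/(ρʲ_{nⱼ} zⱼ))`. -/
def Amat {d : ℕ} (q : Fin d → ℕ+) (z : Fin d → ℂ) :
    Matrix (∀ j, Fin ((q j : ℕ))) (∀ j, Fin ((q j : ℕ))) ℂ :=
  Matrix.diagonal fun n => -(∑ j, (rho (q j) (n j) * z j + (rho (q j) (n j) * z j)⁻¹))

/-- The matrix `B_V` with entries `V̂(n - n')`. -/
def Bmat {d : ℕ} (q : Fin d → ℕ+) (V : (Fin d → ℤ) → ℂ) :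
    Matrix (∀ j, Fin ((q j : ℕ))) (∀ j, Fin ((q j : ℕ))) ℂ :=
  fun n n' => dft q V (fun j => ((n j : ℕ) : ℤ) - ((n' j : ℕ) : ℤ))

/-- The average `[V]` of a periodic potential. -/
def avgPot {d : ℕ} (q : Fin d → ℕ+) (V : (Fin d → ℤ) → ℂ) : ℂ :=
  (1 / ((∏ j, (q j : ℕ) : ℕ) : ℂ)) * ∑ n : (∀ j, Fin ((q j : ℕ))), V (fun j => ((n j : ℕ) : ℤ))

/-- The Fermi variety `F_λ(V)`. -/
def FermiVariety {d : ℕ} (q : Fin d → ℕ+) (V : (Fin d → ℤ) → ℂ) (lam : ℂ) :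
    Set (Fin d → ℂ) :=
  {k | ∃ u : (Fin d → ℤ) → ℂ, u ≠ 0 ∧
    (∀ n, -(discLap u n) + V n * u n = lam * u n) ∧
    (∀ (n : Fin d → ℤ) (j : Fin d),
      u (Function.update n j (n j + ((q j : ℕ) : ℤ)))
        = Complex.exp (2 * (Real.pi : ℂ) * Complex.I * k j) * u n)}

/-- Floquet isospectrality of two real periodic potentials. -/
def FloquetIso {d : ℕ} (q : Fin d → ℕ+) (V Y : (Fin d → ℤ) → ℝ) : Prop :=
  ∀ k : Fin d → ℝ,
    spectrum ℂ (DVmat q (fun n => ((V n : ℝ) : ℂ))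
        (fun j => Complex.exp (2 * (Real.pi : ℂ) * Complex.I * (k j : ℂ))))
      = spectrum ℂ (DVmat q (fun n => ((Y n : ℝ) : ℂ))
        (fun j => Complex.exp (2 * (Real.pi : ℂ) * Complex.I * (k j : ℂ))))

/-- A function on `(ℂ^*)^d` given by a Laurent polynomial. -/
def IsLaurent {d : ℕ} (f : (Fin d → ℂ) → ℂ) : Prop :=
  ∃ c : (Fin d → ℤ) →₀ ℂ, ∀ z : Fin d → ℂ, (∀ j, z j ≠ 0) →
    f z = c.sum fun a C => C * ∏ j, z j ^ a j

/-- A Laurent monomial `C z₁^{a₁} ⋯ z_d^{a_d}` with `C ≠ 0`. -/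
def IsMonomial {d : ℕ} (f : (Fin d → ℂ) → ℂ) : Prop :=
  ∃ (C : ℂ) (a : Fin d → ℤ), C ≠ 0 ∧ ∀ z : Fin d → ℂ, (∀ j, z j ≠ 0) →
    f z = C * ∏ j, z j ^ a j

/-- Irreducibility of a Laurent polynomial: no factorization into two non-monomial
Laurent polynomials. -/
def LaurentIrreducible {d : ℕ} (h : (Fin d → ℂ) → ℂ) : Prop :=
  ¬ ∃ f g : (Fin d → ℂ) → ℂ, IsLaurent f ∧ IsLaurent g ∧
      ¬ IsMonomial f ∧ ¬ IsMonomial g ∧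
      ∀ z : Fin d → ℂ, (∀ j, z j ≠ 0) → h z = f z * g z

/-- Evaluation of the Laurent polynomial with coefficients `c` at the point `w`. -/
def laurentEval {d : ℕ} (c : (Fin d → ℤ) →₀ ℂ) (w : Fin d → ℂ) : ℂ :=
  c.sum fun a C => C * ∏ j, w j ^ a j

/-- The Laurent monomial with exponent `a`, as a character of the torus. -/
def monomialChar {d : ℕ} (a : Fin d → ℤ) : (Fin d → ℂˣ) →* ℂ where
  toFun w := ∏ j, (w j : ℂ) ^ a j
  map_one' := by simp
  map_mul' x y := by simp [mul_zpow, Finset.prod_mul_distrib]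

lemma monomialChar_injective {d : ℕ} :
    Function.Injective (monomialChar : (Fin d → ℤ) → (Fin d → ℂˣ) →* ℂ) := by
  intro a b hab
  funext i
  have h := DFunLike.congr_fun hab
    (Function.update (1 : Fin d → ℂˣ) i (Units.mk0 (2 : ℂ) two_ne_zero))
  have key : ∀ a : Fin d → ℤ, monomialChar a
      (Function.update (1 : Fin d → ℂˣ) i (Units.mk0 (2 : ℂ) two_ne_zero)) = (2 : ℂ) ^ a i := by
    intro a
    change ∏ j, ((Function.update (1 : Fin d → ℂˣ) i
      (Units.mk0 (2 : ℂ) two_ne_zero) j : ℂˣ) : ℂ) ^ a j = _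
    rw [Finset.prod_eq_single i]
    · simp
    · intro j _ hj
      simp [Function.update_of_ne hj]
    · simp
  rw [key, key] at h
  have h2 : (2 : ℝ) ^ a i = (2 : ℝ) ^ b i := by
    simpa [norm_zpow] using congrArg norm h
  exact zpow_right_injective₀ (by norm_num) (by norm_num) h2

lemma laurentEval_injective {d : ℕ} {c c' : (Fin d → ℤ) →₀ ℂ}
    (h : ∀ w : Fin d → ℂ, (∀ j, w j ≠ 0) → laurentEval c w = laurentEval c' w) : c = c' := by
  have hli : LinearIndependent ℂ
      (fun a : Fin d → ℤ => (monomialChar a : (Fin d → ℂˣ) → ℂ)) :=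
    (linearIndependent_monoidHom (Fin d → ℂˣ) ℂ).comp _ monomialChar_injective
  apply hli
  funext w
  have hw := h (fun j => (w j : ℂ)) (fun j => (w j).ne_zero)
  simpa [Finsupp.linearCombination_apply, Finsupp.sum, laurentEval, monomialChar] using hw

lemma exists_laurentEval_mul {d : ℕ} (c c' : (Fin d → ℤ) →₀ ℂ) :
    ∃ e : (Fin d → ℤ) →₀ ℂ,
      (∀ w : Fin d → ℂ, (∀ j, w j ≠ 0) →
        laurentEval e w = laurentEval c w * laurentEval c' w) ∧
      (c ≠ 0 → c' ≠ 0 → e ≠ 0) ∧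
      ∀ x ∈ e.support, ∃ a ∈ c.support, ∃ b ∈ c'.support, a + b = x := by
  classical
  refine ⟨(AddMonoidAlgebra.ofCoeff c * AddMonoidAlgebra.ofCoeff c').coeff, ?_, ?_, ?_⟩
  · intro w hw
    let φ : Multiplicative (Fin d → ℤ) →* ℂ :=
      { toFun := fun a => ∏ j, w j ^ (a.toAdd j)
        map_one' := by simp
        map_mul' := fun a b => by
          simp [zpow_add₀ (hw _), Finset.prod_mul_distrib] }
    have hφ : ∀ f : AddMonoidAlgebra ℂ (Fin d → ℤ),
        laurentEval f.coeff w = AddMonoidAlgebra.lift ℂ ℂ (Fin d → ℤ) φ f := by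
      intro f
      rw [AddMonoidAlgebra.lift_apply]
      rfl
    rw [hφ, map_mul, ← hφ, ← hφ]
  · intro h h' he
    have h0 : AddMonoidAlgebra.ofCoeff c * AddMonoidAlgebra.ofCoeff c' = 0 :=
      AddMonoidAlgebra.coeff_injective he
    rcases mul_eq_zero.mp h0 with h1 | h1
    · exact h (congrArg AddMonoidAlgebra.coeff h1)
    · exact h' (congrArg AddMonoidAlgebra.coeff h1)
  · intro x hx
    have := AddMonoidAlgebra.support_coeff_mul_subset _ _ hx
    simpa [Finset.mem_add] using this

/-- The exponents in `c` on which the weight `θ` takes the value `h`. -/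
def weightPart {d : ℕ} (θ : Fin d → ℤ) (h : ℤ) (c : (Fin d → ℤ) →₀ ℂ) :
    (Fin d → ℤ) →₀ ℂ :=
  c.filter fun a => θ ⬝ᵥ a = h

lemma laurentEval_scale {d : ℕ} (θ : Fin d → ℤ) (c : (Fin d → ℤ) →₀ ℂ) (w : Fin d → ℂ)
    {s : ℂ} (hs : s ≠ 0) (h : ℤ) :
    s ^ h * laurentEval c (fun j => s ^ (-θ j) * w j) =
      c.sum fun a C => s ^ (h - θ ⬝ᵥ a) * (C * ∏ j, w j ^ a j) := by
  unfold laurentEval Finsupp.sum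
  rw [Finset.mul_sum]
  refine Finset.sum_congr rfl fun a _ => ?_
  have : ∏ j, (s ^ (-θ j)) ^ a j = s ^ (-(θ ⬝ᵥ a)) := by
    simp only [← zpow_mul]
    rw [dotProduct, ← Finset.sum_neg_distrib]
    induction (Finset.univ : Finset (Fin d)) using Finset.cons_induction with
    | empty => simp
    | cons i t hi ih => rw [Finset.prod_cons, Finset.sum_cons, zpow_add₀ hs, ih, neg_mul]
  simp only [mul_zpow, Finset.prod_mul_distrib, this]
  rw [sub_eq_add_neg, zpow_add₀ hs]
  ring

lemma tendsto_zpow_nhdsNE_zero {k : ℤ} (hk : 0 ≤ k) :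
    Filter.Tendsto (fun s : ℂ => s ^ k) (nhdsWithin 0 {0}ᶜ)
      (nhds (if k = 0 then 1 else 0)) := by
  lift k to ℕ using hk
  have : (if (k : ℤ) = 0 then (1 : ℂ) else 0) = 0 ^ k := by
    simp [zero_pow_eq]
  rw [this]
  simp only [zpow_natCast]
  exact ((continuous_pow k).tendsto 0).mono_left nhdsWithin_le_nhds

lemma tendsto_laurentEval_scale {d : ℕ} (θ : Fin d → ℤ) (c : (Fin d → ℤ) →₀ ℂ)
    (w : Fin d → ℂ) {h : ℤ} (hc : ∀ a ∈ c.support, θ ⬝ᵥ a ≤ h) :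
    Filter.Tendsto (fun s : ℂ => s ^ h * laurentEval c (fun j => s ^ (-θ j) * w j))
      (nhdsWithin 0 {0}ᶜ) (nhds (laurentEval (weightPart θ h c) w)) := by
  have h1 : laurentEval (weightPart θ h c) w =
      ∑ a ∈ c.support, (if h - θ ⬝ᵥ a = 0 then 1 else 0) * (c a * ∏ j, w j ^ a j) := by
    classical
    rw [laurentEval, Finsupp.sum, weightPart, Finsupp.support_filter, Finset.sum_filter]
    refine Finset.sum_congr rfl fun a _ => ?_
    by_cases hh : θ ⬝ᵥ a = h
    · simp [hh]
    · simp [hh, sub_eq_zero, Ne.symm hh]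
  rw [h1]
  have h2 : Filter.Tendsto (fun s : ℂ => ∑ a ∈ c.support,
      s ^ (h - θ ⬝ᵥ a) * (c a * ∏ j, w j ^ a j)) (nhdsWithin 0 {0}ᶜ) (nhds
      (∑ a ∈ c.support, (if h - θ ⬝ᵥ a = 0 then 1 else 0) * (c a * ∏ j, w j ^ a j))) :=
    tendsto_finsetSum _ fun a ha =>
      (tendsto_zpow_nhdsNE_zero (sub_nonneg.mpr (hc a ha))).mul_const _
  refine h2.congr' ?_
  filter_upwards [self_mem_nhdsWithin] with s hs
  exact (laurentEval_scale θ c w hs h).symm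

lemma exists_top_weight {d : ℕ} (θ : Fin d → ℤ) {c : (Fin d → ℤ) →₀ ℂ} (hc : c ≠ 0) :
    ∃ h : ℤ, (∀ a ∈ c.support, θ ⬝ᵥ a ≤ h) ∧ weightPart θ h c ≠ 0 := by
  obtain ⟨a, ha, hmax⟩ := Finset.exists_max_image c.support (fun a => θ ⬝ᵥ a)
    (Finsupp.support_nonempty_iff.mpr hc)
  refine ⟨θ ⬝ᵥ a, hmax, fun h0 => ?_⟩
  have := DFunLike.congr_fun h0 a
  rw [weightPart, Finsupp.filter_apply_pos (fun b => θ ⬝ᵥ b = θ ⬝ᵥ a) c rfl] at this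
  exact Finsupp.mem_support_iff.mp ha this

lemma mem_support_weightPart {d : ℕ} {θ : Fin d → ℤ} {h : ℤ} {c : (Fin d → ℤ) →₀ ℂ}
    {a : Fin d → ℤ} : a ∈ (weightPart θ h c).support ↔ a ∈ c.support ∧ θ ⬝ᵥ a = h := by
  classical
  simp [weightPart, Finsupp.support_filter]

/-- Factorization of leading parts: if `c * c'` has leading part `R` of weight `N`, then `R` is
the product of the leading parts of `c` and `c'`. -/
lemma exists_leading_factorization {d : ℕ} {c c' : (Fin d → ℤ) →₀ ℂ} (hc : c ≠ 0) (hc' : c' ≠ 0)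
    {P R : (Fin d → ℂ) → ℂ} (hP : ∀ w : Fin d → ℂ, (∀ j, w j ≠ 0) →
      laurentEval c w * laurentEval c' w = P w)
    (θ : Fin d → ℤ) (N : ℤ)
    (hlim : ∀ w : Fin d → ℂ, (∀ j, w j ≠ 0) →
      Filter.Tendsto (fun s : ℂ => s ^ N * P (fun j => s ^ (-θ j) * w j))
        (nhdsWithin 0 {0}ᶜ) (nhds (R w)))
    (hR : ∃ w : Fin d → ℂ, (∀ j, w j ≠ 0) ∧ R w ≠ 0) :
    ∃ h h' : ℤ, h + h' = N ∧ (∀ a ∈ c.support, θ ⬝ᵥ a ≤ h) ∧ (∀ a ∈ c'.support, θ ⬝ᵥ a ≤ h') ∧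
      ∀ w : Fin d → ℂ, (∀ j, w j ≠ 0) →
        laurentEval (weightPart θ h c) w * laurentEval (weightPart θ h' c') w = R w := by
  obtain ⟨h, hmax, htop⟩ := exists_top_weight θ hc
  obtain ⟨h', hmax', htop'⟩ := exists_top_weight θ hc'
  have hprod : ∀ w : Fin d → ℂ, (∀ j, w j ≠ 0) →
      Filter.Tendsto (fun s : ℂ => s ^ (h + h') * P (fun j => s ^ (-θ j) * w j))
        (nhdsWithin 0 {0}ᶜ)
        (nhds (laurentEval (weightPart θ h c) w * laurentEval (weightPart θ h' c') w)) := by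
    intro w hw
    refine ((tendsto_laurentEval_scale θ c w hmax).mul
      (tendsto_laurentEval_scale θ c' w hmax')).congr' ?_
    filter_upwards [self_mem_nhdsWithin] with s hs
    rw [← hP _ fun j => mul_ne_zero (zpow_ne_zero _ hs) (hw j), zpow_add₀ hs]
    ring
  have compare : ∀ {M M' : ℤ} {A B : ℂ} {w : Fin d → ℂ}, M < M' →
      Filter.Tendsto (fun s : ℂ => s ^ M * P (fun j => s ^ (-θ j) * w j))
        (nhdsWithin 0 {0}ᶜ) (nhds A) →
      Filter.Tendsto (fun s : ℂ => s ^ M' * P (fun j => s ^ (-θ j) * w j))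
        (nhdsWithin 0 {0}ᶜ) (nhds B) → B = 0 := by
    intro M M' A B w hM hA hB
    have h0 := tendsto_zpow_nhdsNE_zero (k := M' - M) (by lia)
    rw [if_neg (by lia)] at h0
    have h1 := h0.mul hA
    rw [zero_mul] at h1
    refine tendsto_nhds_unique hB (h1.congr' ?_)
    filter_upwards [self_mem_nhdsWithin] with s hs
    rw [← mul_assoc, ← zpow_add₀ hs, sub_add_cancel]
  have hN : h + h' = N := by
    rcases lt_trichotomy (h + h') N with hlt | heq | hgt
    · obtain ⟨w, hw, hRw⟩ := hR
      exact absurd (compare hlt (hprod w hw) (hlim w hw)) hRw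
    · exact heq
    · obtain ⟨e, he, hne, -⟩ := exists_laurentEval_mul (weightPart θ h c) (weightPart θ h' c')
      refine absurd (laurentEval_injective (c' := 0) fun w hw => ?_) (hne htop htop')
      rw [he w hw, compare hgt (hlim w hw) (hprod w hw)]
      simp [laurentEval]
  refine ⟨h, h', hN, hmax, hmax', fun w hw => ?_⟩
  have := hprod w hw
  rw [hN] at this
  exact tendsto_nhds_unique this (hlim w hw)
/-- If each `σ : Fin d → {±1}` labels an orthant, and the sum of two families `u, v` of points
attached to the vertices `(j, ±1)` of the cross-polytope is injective on each orthant, while one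
of the two families is constant on each orthant, then one of the families is constant. -/
lemma eq_of_constant_on_orthants {d : ℕ} (hd : 3 ≤ d) {α : Type*} [AddCommMagma α]
    (u v : Fin d → ℤˣ → α)
    (hne : ∀ i j s t, i ≠ j → u i s + v i s ≠ u j t + v j t)
    (hor : ∀ σ : Fin d → ℤˣ, (∀ i j, u i (σ i) = u j (σ j)) ∨ (∀ i j, v i (σ i) = v j (σ j))) :
    (∃ a, ∀ i s, u i s = a) ∨ (∃ a, ∀ i s, v i s = a) := by
  have key : ∀ (u v : Fin d → ℤˣ → α)
      (_ : ∀ i j s t, i ≠ j → u i s + v i s ≠ u j t + v j t)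
      (_ : ∀ σ : Fin d → ℤˣ,
        (∀ i j, u i (σ i) = u j (σ j)) ∨ (∀ i j, v i (σ i) = v j (σ j)))
      (_ : ∀ i j, v i 1 = v j 1), ∃ a, ∀ i s, v i s = a := by
    intro u v hne hor h1
    have flip : ∀ (σ : Fin d → ℤˣ) (i : Fin d) (s : ℤˣ), (∀ k l, v k (σ k) = v l (σ l)) →
        ∀ k l, v k (Function.update σ i s k) = v l (Function.update σ i s l) := by
      intro σ i s h
      obtain ⟨k, l, hki, hli, hkl⟩ : ∃ k l : Fin d, k ≠ i ∧ l ≠ i ∧ k ≠ l := by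
        have hcard : 1 < (Finset.univ.erase i).card := by
          rw [Finset.card_erase_of_mem (Finset.mem_univ i), Finset.card_univ, Fintype.card_fin]
          omega
        obtain ⟨k, hk, l, hl, hkl⟩ := Finset.one_lt_card.mp hcard
        exact ⟨k, l, Finset.ne_of_mem_erase hk, Finset.ne_of_mem_erase hl, hkl⟩
      refine (hor (Function.update σ i s)).resolve_left fun hu => ?_
      have := hu k l
      rw [Function.update_of_ne hki, Function.update_of_ne hli] at this
      exact hne k l (σ k) (σ l) hkl (by rw [this, h k l])
    have h0 : 0 < d := by omega
    let o : Fin d := ⟨0, h0⟩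
    refine ⟨v o 1, fun i s => ?_⟩
    have h2 := flip 1 i s h1
    by_cases hi : i = o
    · obtain ⟨k, hk⟩ : ∃ k : Fin d, k ≠ i :=
        ⟨⟨1, by omega⟩, fun h => by simp [← h, o, Fin.ext_iff] at hi⟩
      have := h2 i k
      rw [Function.update_self, Function.update_of_ne hk] at this
      exact this.trans (h1 k o)
    · have := h2 i o
      rwa [Function.update_self, Function.update_of_ne (Ne.symm hi)] at this
  rcases hor 1 with h | h
  · refine Or.inl (key v u ?_ (fun σ => (hor σ).symm) h)
    intro i j s t hij hsum
    rw [add_comm, add_comm (v j t)] at hsum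
    exact hne i j s t hij hsum
  · exact Or.inr (key u v hne hor h)
open MvPolynomial in
lemma mvPolynomial_funext_of_ne_zero {d : ℕ} {p r : MvPolynomial (Fin d) ℂ}
    (h : ∀ w : Fin d → ℂ, (∀ j, w j ≠ 0) → eval w p = eval w r) : p = r :=
  MvPolynomial.funext_set (fun _ => {0}ᶜ) (fun _ => (Set.finite_singleton 0).infinite_compl)
    fun w hw => h w fun j => hw j (Set.mem_univ j)

open MvPolynomial in
/-- After the change of variables `w ↦ w ^ σ` and multiplication by a monomial, a Laurent
polynomial becomes a polynomial. -/
lemma exists_mvPolynomial_eval {d : ℕ} (c : (Fin d → ℤ) →₀ ℂ) (σ : Fin d → ℤ) :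
    ∃ (α : Fin d → ℕ) (p : MvPolynomial (Fin d) ℂ), ∀ w : Fin d → ℂ, (∀ j, w j ≠ 0) →
      eval w p = (∏ j, w j ^ α j) * laurentEval c (fun j => w j ^ σ j) := by
  classical
  let α : Fin d → ℕ := fun j => c.support.sup fun a => (σ j * a j).natAbs
  have hα : ∀ a ∈ c.support, ∀ j, 0 ≤ (α j : ℤ) + σ j * a j := by
    intro a ha j
    have : (σ j * a j).natAbs ≤ α j := Finset.le_sup (f := fun a => (σ j * a j).natAbs) ha
    omega
  refine ⟨α, ∑ a ∈ c.support, monomial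
    (Finsupp.equivFunOnFinite.symm fun j => ((α j : ℤ) + σ j * a j).toNat) (c a), ?_⟩
  intro w hw
  rw [map_sum, laurentEval, Finsupp.sum, Finset.mul_sum]
  refine Finset.sum_congr rfl fun a ha => ?_
  rw [eval_monomial, Finsupp.prod_fintype _ _ (fun _ => pow_zero _), mul_left_comm,
    ← Finset.prod_mul_distrib]
  congr 1
  refine Finset.prod_congr rfl fun j _ => ?_
  rw [← zpow_mul, ← zpow_natCast, ← zpow_natCast, ← zpow_add₀ (hw j)]
  congr 1
  simpa using hα a ha j

open MvPolynomial in
/-- A product of linear forms, permuted transitively by the diagonal symmetries of the factors,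
with no two factors proportional, has no nontrivial factorization into Laurent polynomials with
these symmetries. -/
lemma eq_single_of_mul_eq_prod_linear {d : ℕ} {ι : Type*} [Fintype ι] [Nonempty ι]
    (η : ι → Fin d → ℂ) (i₀ : Fin d)
    (hη : ∀ m j, η m j ≠ 0)
    (hprop : ∀ m m', (∀ i j, η m i * η m' j = η m j * η m' i) → m = m')
    (c c' : (Fin d → ℤ) →₀ ℂ) (σ : Fin d → ℤ) (hσ : ∀ j, σ j = 1 ∨ σ j = -1)
    (hsymm : ∀ m m' (w : Fin d → ℂ), (∀ j, w j ≠ 0) →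
      laurentEval c (fun j => (η m' j / η m j * w j) ^ σ j) = laurentEval c (fun j => w j ^ σ j))
    (hsymm' : ∀ m m' (w : Fin d → ℂ), (∀ j, w j ≠ 0) →
      laurentEval c' (fun j => (η m' j / η m j * w j) ^ σ j) = laurentEval c' (fun j => w j ^ σ j))
    (hmul : ∀ w : Fin d → ℂ, (∀ j, w j ≠ 0) →
      laurentEval c (fun j => w j ^ σ j) * laurentEval c' (fun j => w j ^ σ j) =
        ∏ m, ∑ j, η m j * w j) :
    (∃ a C, c = Finsupp.single a C) ∨ (∃ a C, c' = Finsupp.single a C) := by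
  classical
  obtain ⟨α, p, hp⟩ := exists_mvPolynomial_eval c σ
  obtain ⟨β, p', hp'⟩ := exists_mvPolynomial_eval c' σ
  let ℓ : ι → MvPolynomial (Fin d) ℂ := fun m => sumSMulX (Finsupp.equivFunOnFinite.symm (η m))
  have hℓ : ∀ m, ℓ m = ∑ j, η m j • X j := by
    intro m
    simp only [ℓ, sumSMulX]
    rw [Finsupp.linearCombination_apply, Finsupp.sum_fintype]
    · rfl
    · intro j
      exact zero_smul ℂ _
  have heval : ∀ m w, eval w (ℓ m) = ∑ j, η m j * w j := by
    intro m w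
    simp [hℓ, smul_eval]
  have hirr : ∀ m, Irreducible (ℓ m) := by
    intro m
    refine irreducible_sumSMulX _ ⟨i₀, by simp [hη]⟩ fun r hr => ?_
    exact isUnit_of_dvd_unit (hr i₀) (isUnit_iff_ne_zero.mpr (by simp [hη]))
  have hrel : Pairwise (Function.onFun IsRelPrime ℓ) := by
    intro m m' hm
    refine (hirr m).isRelPrime_iff_not_dvd.mpr fun hdvd => hm (hprop m m' fun i j => ?_)
    obtain ⟨k, hk⟩ := hdvd
    by_cases hij : i = j
    · rw [hij]
    have hw : ∀ m'', eval (Pi.single i (η m j) - Pi.single j (η m i)) (ℓ m'') =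
        η m'' i * η m j - η m'' j * η m i := by
      intro m''
      rw [heval]
      simp [mul_sub, Finset.sum_sub_distrib, Pi.single_apply]
    have := congrArg (eval (Pi.single i (η m j) - Pi.single j (η m i))) hk
    rw [map_mul, hw, hw] at this
    linear_combination (-1 : ℂ) * this
  have hpp : p * p' = monomial (Finsupp.equivFunOnFinite.symm (α + β)) 1 * ∏ m, ℓ m := by
    refine mvPolynomial_funext_of_ne_zero fun w hw => ?_
    rw [map_mul, map_mul, map_prod, hp w hw, hp' w hw, eval_monomial,
      Finsupp.prod_fintype _ _ (fun _ => pow_zero _)]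
    simp only [heval, ← hmul w hw, Finsupp.equivFunOnFinite_symm_apply_apply, Pi.add_apply,
      pow_add, Finset.prod_mul_distrib]
    ring
  have hℓ0 : ∏ m, ℓ m ≠ 0 := Finset.prod_ne_zero_iff.mpr fun m _ => (hirr m).ne_zero
  have main : ∀ (c c' : (Fin d → ℤ) →₀ ℂ) (α β : Fin d → ℕ) (p p' : MvPolynomial (Fin d) ℂ)
      (γ : Fin d →₀ ℕ)
      (_ : ∀ w : Fin d → ℂ, (∀ j, w j ≠ 0) →
        eval w p = (∏ j, w j ^ α j) * laurentEval c (fun j => w j ^ σ j))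
      (_ : ∀ w : Fin d → ℂ, (∀ j, w j ≠ 0) →
        eval w p' = (∏ j, w j ^ β j) * laurentEval c' (fun j => w j ^ σ j))
      (_ : ∀ m m' (w : Fin d → ℂ), (∀ j, w j ≠ 0) →
        laurentEval c (fun j => (η m' j / η m j * w j) ^ σ j) =
          laurentEval c (fun j => w j ^ σ j))
      (_ : p * p' = monomial γ 1 * ∏ m, ℓ m) (m₀ : ι) (_ : ℓ m₀ ∣ p),
      ∃ a C, c' = Finsupp.single a C := by
    intro c c' α β p p' γ hp hp' hsymm hpp m₀ hdvd
    have hall : ∀ m, ℓ m ∣ p := by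
      intro m
      let φ : MvPolynomial (Fin d) ℂ →ₐ[ℂ] MvPolynomial (Fin d) ℂ :=
        aeval fun j => C (η m j / η m₀ j) * X j
      have hφ : ∀ w (f : MvPolynomial (Fin d) ℂ),
          eval w (φ f) = eval (fun j => η m j / η m₀ j * w j) f := by
        intro w f
        induction f using MvPolynomial.induction_on with
        | C a => simp [φ]
        | add f g hf hg => simp only [map_add, hf, hg]
        | mul_X f j hf => simp only [map_mul, hf]; simp [φ]
      have h1 : φ (ℓ m₀) = ℓ m := by
        refine MvPolynomial.funext fun w => ?_
        rw [hφ, heval, heval]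
        refine Finset.sum_congr rfl fun j _ => ?_
        have := hη m₀ j
        field_simp
      have h2 : φ p = C (∏ j, (η m j / η m₀ j) ^ α j) * p := by
        refine mvPolynomial_funext_of_ne_zero fun w hw => ?_
        rw [hφ, hp _ fun j => mul_ne_zero (div_ne_zero (hη m j) (hη m₀ j)) (hw j), map_mul,
          eval_C, hp w hw, hsymm _ _ w hw]
        simp only [mul_pow, Finset.prod_mul_distrib, mul_assoc]
      have h3 := map_dvd φ hdvd
      rw [h1, h2] at h3
      refine (IsUnit.dvd_mul_left ?_).mp h3
      refine IsUnit.map C (isUnit_iff_ne_zero.mpr ?_)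
      exact Finset.prod_ne_zero_iff.mpr fun j _ => pow_ne_zero _ (div_ne_zero (hη m j) (hη m₀ j))
    obtain ⟨H, hH⟩ := Fintype.prod_dvd_of_isRelPrime hrel hall
    have hdvd' : p' ∣ monomial γ 1 := by
      refine ⟨H, mul_right_cancel₀ hℓ0 ?_⟩
      rw [← hpp, hH]
      ring
    obtain ⟨μ, b, -, -, hmon⟩ := (dvd_monomial_iff_exists one_ne_zero).mp hdvd'
    refine ⟨fun j => σ j * (μ j - β j), b, laurentEval_injective fun w hw => ?_⟩
    have hw' : ∀ j, w j ^ σ j ≠ 0 := fun j => zpow_ne_zero _ (hw j)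
    have hinv : (fun j => (w j ^ σ j) ^ σ j) = w := by
      funext j
      rw [← zpow_mul]
      rcases hσ j with h | h <;> simp [h]
    have h4 := hp' (fun j => w j ^ σ j) hw'
    rw [hinv, hmon, eval_monomial, Finsupp.prod_fintype _ _ (fun _ => pow_zero _)] at h4
    have h5 : laurentEval (Finsupp.single (fun j => σ j * ((μ j : ℤ) - β j)) b) w =
        b * ((∏ j, (w j ^ σ j) ^ μ j) / ∏ j, (w j ^ σ j) ^ β j) := by
      rw [laurentEval, Finsupp.sum_single_index (by simp), ← Finset.prod_div_distrib]
      congr 1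
      refine Finset.prod_congr rfl fun j _ => ?_
      rw [zpow_mul, zpow_sub₀ (hw' j), zpow_natCast, zpow_natCast]
    have h6 : ∏ j, (w j ^ σ j) ^ β j ≠ 0 :=
      Finset.prod_ne_zero_iff.mpr fun j _ => pow_ne_zero _ (hw' j)
    rw [h5, ← mul_div_assoc, h4, mul_div_cancel_left₀ _ h6]
  obtain ⟨m₀⟩ := ‹Nonempty ι›
  have hdvd : ℓ m₀ ∣ p * p' :=
    hpp ▸ (Finset.dvd_prod_of_mem ℓ (Finset.mem_univ m₀)).mul_left _
  rcases (hirr m₀).prime.dvd_or_dvd hdvd with h | h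
  · exact Or.inr (main c c' α β p p' _ hp hp' hsymm hpp m₀ h)
  · exact Or.inl (main c' c β α p' p _ hp' hp hsymm' (by rw [mul_comm, hpp]) m₀ h)
lemma rho_eq_pow (q : ℕ+) (m : ℕ) : rho q m = rho q 1 ^ m := by
  rw [rho, rho, ← Complex.exp_nat_mul]
  congr 1
  push_cast
  ring

lemma isPrimitiveRoot_rho_one (q : ℕ+) : IsPrimitiveRoot (rho q 1) q := by
  simpa [rho] using Complex.isPrimitiveRoot_exp q q.ne_zero

lemma rho_ne_zero (q : ℕ+) (m : ℕ) : rho q m ≠ 0 := Complex.exp_ne_zero _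

lemma rho_pow_self (q : ℕ+) (m : ℕ) : rho q m ^ (q : ℕ) = 1 := by
  rw [rho_eq_pow, ← pow_mul, mul_comm, pow_mul, (isPrimitiveRoot_rho_one q).pow_eq_one, one_pow]

lemma rho_injective (q : ℕ+) {m m' : Fin (q : ℕ)} (h : rho q m = rho q m') : m = m' := by
  rw [rho_eq_pow, rho_eq_pow q m'] at h
  exact Fin.ext ((isPrimitiveRoot_rho_one q).pow_inj m.2 m'.2 h)

lemma sum_rho_pow_mul (q : ℕ+) (m m' : Fin (q : ℕ)) :
    ∑ k : Fin (q : ℕ), rho q m ^ (k : ℕ) * (rho q m')⁻¹ ^ (k : ℕ) =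
      if m = m' then ((q : ℕ) : ℂ) else 0 := by
  simp only [← mul_pow]
  rw [Fin.sum_univ_eq_sum_range (fun k => (rho q m * (rho q m')⁻¹) ^ k)]
  split_ifs with h
  · simp [h, rho_ne_zero]
  · have h1 : rho q m * (rho q m')⁻¹ ≠ 1 := by
      rw [← div_eq_mul_inv, Ne, div_eq_one_iff_eq (rho_ne_zero q _)]
      exact fun h2 => h (rho_injective q h2)
    rw [geom_sum_eq h1, mul_pow, inv_pow, rho_pow_self, rho_pow_self]
    simp

/-- The Fourier matrix of `∏ j, ℤ / q j`. -/
def fourierMat {d : ℕ} (q : Fin d → ℕ+) :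
    Matrix (∀ j, Fin ((q j : ℕ))) (∀ j, Fin ((q j : ℕ))) ℂ :=
  fun n m => ∏ j, rho (q j) (m j) ^ (n j : ℕ)

lemma isUnit_det_fourierMat {d : ℕ} (q : Fin d → ℕ+) : IsUnit (fourierMat q).det := by
  let G : Matrix (∀ j, Fin ((q j : ℕ))) (∀ j, Fin ((q j : ℕ))) ℂ :=
    fun m n => ∏ j, (rho (q j) (m j))⁻¹ ^ (n j : ℕ)
  have h : G * fourierMat q = (∏ j, ((q j : ℕ) : ℂ)) • 1 := by
    ext m m'
    rw [Matrix.mul_apply]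
    simp only [G, fourierMat, ← Finset.prod_mul_distrib]
    rw [← Fintype.prod_sum fun j (k : Fin (q j : ℕ)) =>
      (rho (q j) (m j))⁻¹ ^ (k : ℕ) * rho (q j) (m' j) ^ (k : ℕ)]
    simp only [mul_comm ((rho _ _)⁻¹ ^ _), sum_rho_pow_mul]
    rw [Matrix.smul_apply, Matrix.one_apply]
    split_ifs with hm
    · simp [hm]
    · obtain ⟨j, hj⟩ := Function.ne_iff.mp hm
      simpa using Finset.prod_eq_zero (Finset.mem_univ j) (if_neg (Ne.symm hj))
  have h1 := congrArg Matrix.det h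
  rw [Matrix.det_mul, Matrix.det_smul, Matrix.det_one, mul_one] at h1
  refine isUnit_iff_ne_zero.mpr fun h0 => ?_
  rw [h0, mul_zero] at h1
  refine absurd h1.symm (pow_ne_zero _ (Finset.prod_ne_zero_iff.mpr fun j _ => ?_))
  exact_mod_cast (q j).ne_zero

lemma extendBC_eq_sum {d : ℕ} (q : Fin d → ℕ+) (z : Fin d → ℂ)
    (u : (∀ j, Fin ((q j : ℕ))) → ℂ) (x : Fin d → ℤ) :
    extendBC q z u x = ∑ n', extendBC q z (Pi.single n' 1) x * u n' := by
  simp [extendBC, Pi.single_apply]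

lemma DVmat_mulVec {d : ℕ} (q : Fin d → ℕ+) (V : (Fin d → ℤ) → ℂ) (z : Fin d → ℂ)
    (u : (∀ j, Fin ((q j : ℕ))) → ℂ) (n : ∀ j, Fin ((q j : ℕ))) :
    (DVmat q V z).mulVec u n =
      -(discLap (extendBC q z u) (fun j => ((n j : ℕ) : ℤ))) +
        V (fun j => ((n j : ℕ) : ℤ)) * u n := by
  have h : discLap (extendBC q z u) (fun j => ((n j : ℕ) : ℤ)) =
      ∑ n', discLap (extendBC q z (Pi.single n' 1)) (fun j => ((n j : ℕ) : ℤ)) * u n' := by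
    simp only [discLap, extendBC_eq_sum q z u, Finset.sum_mul, add_mul]
    rw [Finset.sum_comm]
    simp only [Finset.sum_add_distrib]
  rw [Matrix.mulVec, dotProduct, h]
  simp [DVmat, add_mul, Finset.sum_add_distrib]

/-- Plane waves satisfy the Floquet boundary conditions. -/
lemma extendBC_planeWave {d : ℕ} (q : Fin d → ℕ+) (y : Fin d → ℂ) (hy : ∀ j, y j ≠ 0)
    (x : Fin d → ℤ) :
    extendBC q (fun j => y j ^ (q j : ℕ)) (fun n => ∏ j, y j ^ (n j : ℕ)) x =
      ∏ j, y j ^ x j := by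
  rw [extendBC, ← Finset.prod_mul_distrib]
  refine Finset.prod_congr rfl fun j _ => ?_
  have hq : ((q j : ℕ) : ℤ) ≠ 0 := by exact_mod_cast (q j).ne_zero
  have h1 : ((fem (q j) (x j) : ℕ) : ℤ) = x j % ((q j : ℕ) : ℤ) :=
    Int.toNat_of_nonneg (Int.emod_nonneg _ hq)
  rw [← zpow_natCast, ← zpow_natCast, ← zpow_mul, ← zpow_add₀ (hy j), h1, Int.mul_ediv_add_emod]

lemma discLap_planeWave {d : ℕ} (y : Fin d → ℂ) (hy : ∀ j, y j ≠ 0) (x : Fin d → ℤ) :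
    discLap (fun x => ∏ j, y j ^ x j) x = (∑ j, (y j + (y j)⁻¹)) * ∏ j, y j ^ x j := by
  have h : ∀ (i : Fin d) (k : ℤ),
      ∏ j, y j ^ Function.update x i (x i + k) j = y i ^ k * ∏ j, y j ^ x j := by
    intro i k
    rw [← Finset.mul_prod_erase _ _ (Finset.mem_univ i),
      ← Finset.mul_prod_erase (f := fun j => y j ^ x j) _ (Finset.mem_univ i),
      Function.update_self, zpow_add₀ (hy i), mul_comm (y i ^ x i), mul_assoc]
    congr 2
    refine Finset.prod_congr rfl fun j hj => ?_
    rw [Function.update_of_ne (Finset.ne_of_mem_erase hj)]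
  simp only [discLap, sub_eq_add_neg, h, zpow_one, zpow_neg_one]
  rw [Finset.sum_mul]
  simp only [add_mul]

/-- In the Fourier basis, the Floquet matrix is a diagonal symbol plus a constant matrix. -/
lemma exists_scriptP_eq_det {d : ℕ} (q : Fin d → ℕ+) (V : (Fin d → ℤ) → ℂ) (lam : ℂ) :
    ∃ B : Matrix (∀ j, Fin ((q j : ℕ))) (∀ j, Fin ((q j : ℕ))) ℂ,
      ∀ w : Fin d → ℂ, (∀ j, w j ≠ 0) → scriptP q V (fun j => w j ^ (q j : ℕ)) lam =
        (Matrix.diagonal (fun m : ∀ j, Fin ((q j : ℕ)) =>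
          -∑ j, (rho (q j) (m j) * w j + (rho (q j) (m j) * w j)⁻¹)) + B).det := by
  have hF := isUnit_det_fourierMat q
  let E : Matrix (∀ j, Fin ((q j : ℕ))) (∀ j, Fin ((q j : ℕ))) ℂ :=
    Matrix.diagonal fun n => V (fun j => ((n j : ℕ) : ℤ)) - lam
  refine ⟨(fourierMat q)⁻¹ * E * fourierMat q, fun w hw => ?_⟩
  set z : Fin d → ℂ := fun j => w j ^ (q j : ℕ) with hz
  set S : (∀ j, Fin ((q j : ℕ))) → ℂ := fun m =>
    -∑ j, (rho (q j) (m j) * w j + (rho (q j) (m j) * w j)⁻¹) with hS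
  let T : Matrix (∀ j, Fin ((q j : ℕ))) (∀ j, Fin ((q j : ℕ))) ℂ :=
    Matrix.diagonal fun n => ∏ j, w j ^ (n j : ℕ)
  have hU : ∀ n m, (T * fourierMat q) n m = ∏ j, (rho (q j) (m j) * w j) ^ (n j : ℕ) := by
    intro n m
    simp only [T, Matrix.diagonal_mul, fourierMat, ← Finset.prod_mul_distrib, mul_pow, mul_comm]
  have hcol : (DVmat q V z - lam • 1) * (T * fourierMat q) =
      T * fourierMat q * Matrix.diagonal S + E * (T * fourierMat q) := by
    ext n m
    have hy : ∀ j, rho (q j) (m j) * w j ≠ 0 := fun j => mul_ne_zero (rho_ne_zero _ _) (hw j)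
    have h1 : (DVmat q V z * (T * fourierMat q)) n m =
        (DVmat q V z).mulVec (fun n => ∏ j, (rho (q j) (m j) * w j) ^ (n j : ℕ)) n := by
      rw [Matrix.mul_apply, Matrix.mulVec, dotProduct]
      simp only [hU]
    have h2 : z = fun j => (rho (q j) (m j) * w j) ^ (q j : ℕ) := by
      funext j
      rw [mul_pow, rho_pow_self, one_mul]
    have h3 : extendBC q z (fun n => ∏ j, (rho (q j) (m j) * w j) ^ (n j : ℕ)) =
        fun x => ∏ j, (rho (q j) (m j) * w j) ^ x j := by
      funext x
      rw [h2]
      exact extendBC_planeWave q _ hy x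
    have h4 : (E * (T * fourierMat q)) n m =
        (V (fun j => ((n j : ℕ) : ℤ)) - lam) * (T * fourierMat q) n m :=
      Matrix.diagonal_mul _ _ _ _
    rw [sub_mul, Matrix.sub_apply, h1, DVmat_mulVec, h3, discLap_planeWave _ hy, Matrix.add_apply,
      Matrix.mul_diagonal, h4, smul_mul_assoc, one_mul, Matrix.smul_apply, hU, hS]
    simp only [zpow_natCast, smul_eq_mul]
    ring
  have hT : T.det ≠ 0 := by
    rw [Matrix.det_diagonal]
    exact Finset.prod_ne_zero_iff.mpr fun n _ =>
      Finset.prod_ne_zero_iff.mpr fun j _ => pow_ne_zero _ (hw j)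
  have hET : E * T = T * E := by
    simp only [E, T, Matrix.diagonal_mul_diagonal, mul_comm]
  have hfact : (DVmat q V z - lam • 1) * (T * fourierMat q) =
      T * fourierMat q *
        (Matrix.diagonal S + (fourierMat q)⁻¹ * E * fourierMat q) := by
    rw [hcol, mul_add, ← mul_assoc E, hET]
    congr 1
    simp only [mul_assoc]
    rw [Matrix.mul_nonsing_inv_cancel_left _ _ hF]
  have hdet := congrArg Matrix.det hfact
  rw [Matrix.det_mul, Matrix.det_mul (T * fourierMat q), mul_comm] at hdet
  refine mul_left_cancel₀ ?_ hdet
  rw [Matrix.det_mul]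
  exact mul_ne_zero hT hF.ne_zero

lemma tendsto_symbol_scale {t : ℤ} (ht : t = 0 ∨ t = 1 ∨ t = -1) (y : ℂ) :
    Filter.Tendsto (fun s : ℂ => s * (s ^ (-t) * y + (s ^ (-t) * y)⁻¹)) (nhdsWithin 0 {0}ᶜ)
      (nhds (if t = 0 then 0 else y ^ t)) := by
  have lift : ∀ (f : ℂ → ℂ) (L : ℂ), Continuous f → f 0 = L →
      (∀ s : ℂ, s ≠ 0 → f s = s * (s ^ (-t) * y + (s ^ (-t) * y)⁻¹)) →
      Filter.Tendsto (fun s : ℂ => s * (s ^ (-t) * y + (s ^ (-t) * y)⁻¹)) (nhdsWithin 0 {0}ᶜ)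
        (nhds L) := by
    intro f L hf hL h
    rw [← hL]
    refine ((hf.tendsto 0).mono_left nhdsWithin_le_nhds).congr' ?_
    filter_upwards [self_mem_nhdsWithin] with s hs using h s hs
  rcases ht with rfl | rfl | rfl
  · exact lift (fun s => s * (y + y⁻¹)) _ (by fun_prop) (by simp) fun s hs => by simp
  · refine lift (fun s => y + s ^ 2 * y⁻¹) _ (by fun_prop) (by simp) fun s hs => ?_
    rw [mul_inv, zpow_neg_one, inv_inv, mul_add, mul_inv_cancel_left₀ hs]
    ring
  · refine lift (fun s => s ^ 2 * y + y⁻¹) _ (by fun_prop) (by simp) fun s hs => ?_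
    rw [mul_inv, neg_neg, zpow_one, mul_add, mul_inv_cancel_left₀ hs]
    ring

/-- The leading part of the Floquet determinant in a direction `θ` with entries in `{0, ±1}`. -/
lemma tendsto_scriptP_scale {d : ℕ} (q : Fin d → ℕ+) (V : (Fin d → ℤ) → ℂ) (lam : ℂ)
    (θ : Fin d → ℤ) (hθ : ∀ j, θ j = 0 ∨ θ j = 1 ∨ θ j = -1)
    (w : Fin d → ℂ) (hw : ∀ j, w j ≠ 0) :
    Filter.Tendsto (fun s : ℂ => s ^ (Fintype.card (∀ j, Fin ((q j : ℕ))) : ℤ) *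
        scriptP q V (fun j => (s ^ (-θ j) * w j) ^ (q j : ℕ)) lam) (nhdsWithin 0 {0}ᶜ)
      (nhds (∏ m : ∀ j, Fin ((q j : ℕ)),
        -∑ j, if θ j = 0 then 0 else (rho (q j) (m j) * w j) ^ θ j)) := by
  obtain ⟨B, hB⟩ := exists_scriptP_eq_det q V lam
  rw [← Matrix.det_diagonal]
  have hlim : Filter.Tendsto (fun s : ℂ => Matrix.diagonal (fun m : ∀ j, Fin ((q j : ℕ)) =>
        -∑ j, s * (s ^ (-θ j) * (rho (q j) (m j) * w j) +
          (s ^ (-θ j) * (rho (q j) (m j) * w j))⁻¹)) + s • B) (nhdsWithin 0 {0}ᶜ)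
      (nhds (Matrix.diagonal (fun m : ∀ j, Fin ((q j : ℕ)) =>
        -∑ j, if θ j = 0 then 0 else (rho (q j) (m j) * w j) ^ θ j) + (0 : ℂ) • B)) := by
    refine Filter.Tendsto.add ?_ ?_
    · refine ((continuous_id.matrix_diagonal).tendsto _).comp (tendsto_pi_nhds.mpr fun m => ?_)
      exact (tendsto_finsetSum _ fun j _ => tendsto_symbol_scale (hθ j) _).neg
    · exact ((continuous_id.smul continuous_const).tendsto 0).mono_left nhdsWithin_le_nhds
  rw [zero_smul, add_zero] at hlim
  refine (((continuous_id.matrix_det).tendsto _).comp hlim).congr' ?_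
  filter_upwards [self_mem_nhdsWithin] with s hs
  rw [hB _ fun j => mul_ne_zero (zpow_ne_zero _ hs) (hw j), zpow_natCast, ← Matrix.det_smul,
    smul_add, Function.comp_apply, id, ← Matrix.diagonal_smul]
  congr 3
  funext m
  simp only [Pi.smul_apply, smul_eq_mul, mul_neg, Finset.mul_sum, mul_left_comm (rho _ _)]
lemma laurentEval_weightPart_mul {d : ℕ} {c : (Fin d → ℤ) →₀ ℂ} {ζ : Fin d → ℂ}
    (hsymm : ∀ w : Fin d → ℂ, (∀ j, w j ≠ 0) →
      laurentEval c (fun j => ζ j * w j) = laurentEval c w)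
    {θ : Fin d → ℤ} {h : ℤ} (hc : ∀ a ∈ c.support, θ ⬝ᵥ a ≤ h)
    (w : Fin d → ℂ) (hw : ∀ j, w j ≠ 0) :
    laurentEval (weightPart θ h c) (fun j => ζ j * w j) = laurentEval (weightPart θ h c) w := by
  refine tendsto_nhds_unique (tendsto_laurentEval_scale θ c _ hc)
    ((tendsto_laurentEval_scale θ c w hc).congr' ?_)
  filter_upwards [self_mem_nhdsWithin] with s hs
  rw [← hsymm _ fun j => mul_ne_zero (zpow_ne_zero _ hs) (hw j)]
  simp only [mul_left_comm]

lemma eq_of_rho_ratio_eq {d : ℕ} (hd : 2 ≤ d) {q : Fin d → ℕ+}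
    (hq : ∀ i j, i ≠ j → Nat.Coprime (q i) (q j)) (σ : Fin d → ℤˣ)
    (m m' : ∀ j, Fin ((q j : ℕ)))
    (h : ∀ i j, rho (q i) (m i) ^ (σ i : ℤ) * rho (q j) (m' j) ^ (σ j : ℤ) =
      rho (q j) (m j) ^ (σ j : ℤ) * rho (q i) (m' i) ^ (σ i : ℤ)) : m = m' := by
  let x : Fin d → ℂ := fun i => (rho (q i) (m i) / rho (q i) (m' i)) ^ (σ i : ℤ)
  have hx : ∀ i, x i ^ (q i : ℕ) = 1 := by
    intro i
    rw [← zpow_natCast, ← zpow_mul, mul_comm, zpow_mul, zpow_natCast, div_pow, rho_pow_self,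
      rho_pow_self, div_one, one_zpow]
  have hxx : ∀ i j, x i = x j := by
    intro i j
    simp only [x, div_zpow]
    rw [div_eq_div_iff (zpow_ne_zero _ (rho_ne_zero _ _)) (zpow_ne_zero _ (rho_ne_zero _ _))]
    exact h i j
  funext i
  obtain ⟨j, hj⟩ : ∃ j : Fin d, j ≠ i := by
    have : Nontrivial (Fin d) := Fin.nontrivial_iff_two_le.mpr hd
    exact exists_ne i
  have h1 : x i = 1 := by
    have := pow_gcd_eq_one.mpr ⟨hx i, (by rw [hxx i j, hx j] : x i ^ (q j : ℕ) = 1)⟩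
    rwa [(hq i j hj.symm).gcd_eq_one, pow_one] at this
  refine rho_injective (q i) ((div_eq_one_iff_eq (rho_ne_zero _ _)).mp ?_)
  rcases Int.units_eq_one_or (σ i) with hs | hs
  · simpa [x, hs] using h1
  · simpa [x, hs] using congrArg (·⁻¹) h1

lemma exists_sum_zpow_ne_zero {d : ℕ} [NeZero d] (σ : Fin d → ℤˣ) :
    ∃ w : Fin d → ℂ, (∀ j, w j ≠ 0) ∧
      ∀ ρ : Fin d → ℂ, (∀ j, ‖ρ j‖ = 1) → ∑ j, (ρ j * w j) ^ (σ j : ℤ) ≠ 0 := by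
  have hd : (d : ℂ) ≠ 0 := by exact_mod_cast NeZero.ne d
  refine ⟨fun j => (if j = 0 then (d : ℂ) else 1) ^ (σ j : ℤ), fun j => zpow_ne_zero _ ?_,
    fun ρ hρ h0 => ?_⟩
  · split_ifs <;> simp [hd]
  have hnorm : ∀ j, ‖(ρ j * (if j = 0 then (d : ℂ) else 1) ^ (σ j : ℤ)) ^ (σ j : ℤ)‖ =
      if j = 0 then (d : ℝ) else 1 := by
    intro j
    rw [mul_zpow, ← zpow_mul, ← Units.val_mul, Int.units_mul_self]
    simp only [Units.val_one, zpow_one, norm_mul, norm_zpow, hρ, one_zpow, one_mul]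
    split_ifs <;> simp
  rw [← Finset.add_sum_erase _ _ (Finset.mem_univ 0)] at h0
  have h1 := hnorm 0
  rw [eq_neg_of_add_eq_zero_left h0, norm_neg, if_pos rfl] at h1
  have h2 := norm_sum_le (Finset.univ.erase (0 : Fin d)) fun j =>
    (ρ j * (if j = 0 then (d : ℂ) else 1) ^ (σ j : ℤ)) ^ (σ j : ℤ)
  rw [h1, Finset.sum_congr rfl fun j hj =>
    (hnorm j).trans (if_neg (Finset.ne_of_mem_erase hj))] at h2
  rw [Finset.sum_const, Finset.card_erase_of_mem (Finset.mem_univ _), Finset.card_univ,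
    Fintype.card_fin, nsmul_eq_mul, mul_one] at h2
  have h3 : d ≤ d - 1 := by exact_mod_cast h2
  have := NeZero.pos d
  omega

lemma norm_rho (q : ℕ+) (m : ℕ) : ‖rho q m‖ = 1 :=
  Complex.norm_eq_one_of_pow_eq_one (rho_pow_self q m) q.ne_zero

/-- The exponents of the two factors adding up to the vertex `(i, s)` of the Newton polytope. -/
lemma exists_vertex_decomposition {d : ℕ} (q : Fin d → ℕ+) (V : (Fin d → ℤ) → ℂ) (lam : ℂ)
    {c c' : (Fin d → ℤ) →₀ ℂ} (hc : c ≠ 0) (hc' : c' ≠ 0)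
    (hP : ∀ w : Fin d → ℂ, (∀ j, w j ≠ 0) →
      laurentEval c w * laurentEval c' w = scriptP q V (fun j => w j ^ (q j : ℕ)) lam)
    (i : Fin d) (s : ℤˣ) :
    ∃ u ∈ c.support, ∃ v ∈ c'.support,
      u + v = Pi.single i ((s : ℤ) * Fintype.card (∀ j, Fin ((q j : ℕ)))) ∧
      (∀ a ∈ c.support, (s : ℤ) * a i ≤ s * u i) ∧
      ∀ a ∈ c'.support, (s : ℤ) * a i ≤ s * v i := by
  classical
  let K : ℂ := ∏ m : ∀ j, Fin ((q j : ℕ)), -rho (q i) (m i) ^ (s : ℤ)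
  have hK : K ≠ 0 := Finset.prod_ne_zero_iff.mpr fun m _ =>
    neg_ne_zero.mpr (zpow_ne_zero _ (rho_ne_zero _ _))
  have hR : ∀ w : Fin d → ℂ, (∏ m : ∀ j, Fin ((q j : ℕ)),
      -∑ j, if (Pi.single i (s : ℤ) : Fin d → ℤ) j = 0 then 0
        else (rho (q j) (m j) * w j) ^ (Pi.single i (s : ℤ) : Fin d → ℤ) j) =
      K * w i ^ ((s : ℤ) * Fintype.card (∀ j, Fin ((q j : ℕ)))) := by
    intro w
    have : ∀ m : ∀ j, Fin ((q j : ℕ)),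
        (-∑ j, if (Pi.single i (s : ℤ) : Fin d → ℤ) j = 0 then (0 : ℂ)
          else (rho (q j) (m j) * w j) ^ (Pi.single i (s : ℤ) : Fin d → ℤ) j) =
        -rho (q i) (m i) ^ (s : ℤ) * w i ^ (s : ℤ) := by
      intro m
      rw [Finset.sum_eq_single i]
      · simp [mul_zpow]
      · intro j _ hj
        simp [hj]
      · simp
    simp only [this, Finset.prod_mul_distrib, Finset.prod_const, Finset.card_univ, K]
    rw [zpow_mul, zpow_natCast]
  obtain ⟨h, h', -, hmax, hmax', hfac⟩ := exists_leading_factorization hc hc' hP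
    (Pi.single i (s : ℤ)) (Fintype.card (∀ j, Fin ((q j : ℕ))))
    (fun w hw => tendsto_scriptP_scale q V lam _ (fun j => by
      by_cases hj : j = i
      · subst hj
        rcases Int.units_eq_one_or s with hs | hs <;> simp [hs]
      · simp [hj]) w hw)
    ⟨1, by simp, by rw [hR]; simpa using hK⟩
  obtain ⟨e, he, -, hsupp⟩ := exists_laurentEval_mul
    (weightPart (Pi.single i (s : ℤ)) h c) (weightPart (Pi.single i (s : ℤ)) h' c')
  have heq : e = Finsupp.single
      (Pi.single i ((s : ℤ) * Fintype.card (∀ j, Fin ((q j : ℕ))))) K := by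
    refine laurentEval_injective fun w hw => ?_
    rw [he w hw, hfac w hw, hR, laurentEval, Finsupp.sum_single_index (by simp),
      Finset.prod_eq_single i]
    · simp
    · intro j _ hj
      simp [hj]
    · simp
  obtain ⟨u, hu, v, hv, huv⟩ := hsupp
    (Pi.single i ((s : ℤ) * Fintype.card (∀ j, Fin ((q j : ℕ))))) (by simp [heq, hK])
  rw [mem_support_weightPart, single_dotProduct] at hu hv
  refine ⟨u, hu.1, v, hv.1, huv, fun a ha => ?_, fun a ha => ?_⟩
  · rw [hu.2]
    simpa using hmax a ha
  · rw [hv.2]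
    simpa using hmax' a ha

/-- On each facet of the Newton polytope, one of the two factors contributes a single exponent. -/
lemma exists_facet_single {d : ℕ} (hd : 2 ≤ d) (q : Fin d → ℕ+)
    (hq : ∀ i j, i ≠ j → Nat.Coprime (q i) (q j)) (V : (Fin d → ℤ) → ℂ) (lam : ℂ)
    {c c' : (Fin d → ℤ) →₀ ℂ} (hc : c ≠ 0) (hc' : c' ≠ 0)
    (hP : ∀ w : Fin d → ℂ, (∀ j, w j ≠ 0) →
      laurentEval c w * laurentEval c' w = scriptP q V (fun j => w j ^ (q j : ℕ)) lam)
    (hsymm : ∀ ζ w : Fin d → ℂ, (∀ j, ζ j ^ (q j : ℕ) = 1) → (∀ j, w j ≠ 0) →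
      laurentEval c (fun j => ζ j * w j) = laurentEval c w)
    (hsymm' : ∀ ζ w : Fin d → ℂ, (∀ j, ζ j ^ (q j : ℕ) = 1) → (∀ j, w j ≠ 0) →
      laurentEval c' (fun j => ζ j * w j) = laurentEval c' w)
    (σ : Fin d → ℤˣ) :
    ∃ h h' : ℤ, h + h' = Fintype.card (∀ j, Fin ((q j : ℕ))) ∧
      (∀ a ∈ c.support, (fun j => (σ j : ℤ)) ⬝ᵥ a ≤ h) ∧
      (∀ a ∈ c'.support, (fun j => (σ j : ℤ)) ⬝ᵥ a ≤ h') ∧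
      ((∃ a C, weightPart (fun j => (σ j : ℤ)) h c = Finsupp.single a C) ∨
        ∃ a C, weightPart (fun j => (σ j : ℤ)) h' c' = Finsupp.single a C) := by
  have : NeZero d := ⟨by omega⟩
  have hσ : ∀ j, (σ j : ℤ) = 1 ∨ (σ j : ℤ) = -1 := by
    intro j
    rcases Int.units_eq_one_or (σ j) with hs | hs <;> simp [hs]
  have hσσ : ∀ (j) (y : ℂ), (y ^ (σ j : ℤ)) ^ (σ j : ℤ) = y := by
    intro j y
    rw [← zpow_mul, ← Units.val_mul, Int.units_mul_self, Units.val_one, zpow_one]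
  obtain ⟨h, h', hsum, hmax, hmax', hfac⟩ := exists_leading_factorization hc hc' hP
    (fun j => (σ j : ℤ)) (Fintype.card (∀ j, Fin ((q j : ℕ))))
    (fun w hw => tendsto_scriptP_scale q V lam _ (fun j => Or.inr (hσ j)) w hw) (by
      obtain ⟨w, hw, hne⟩ := exists_sum_zpow_ne_zero σ
      refine ⟨w, hw, Finset.prod_ne_zero_iff.mpr fun m _ => neg_ne_zero.mpr ?_⟩
      simpa using hne (fun j => rho (q j) (m j)) fun j => norm_rho _ _)
  refine ⟨h, h', hsum, hmax, hmax', ?_⟩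
  let η : (∀ j, Fin ((q j : ℕ))) → Fin d → ℂ := fun m j => -rho (q j) (m j) ^ (σ j : ℤ)
  have hrot : ∀ (c : (Fin d → ℤ) →₀ ℂ) (h : ℤ)
      (_ : ∀ ζ w : Fin d → ℂ, (∀ j, ζ j ^ (q j : ℕ) = 1) → (∀ j, w j ≠ 0) →
        laurentEval c (fun j => ζ j * w j) = laurentEval c w)
      (_ : ∀ a ∈ c.support, (fun j => (σ j : ℤ)) ⬝ᵥ a ≤ h)
      (m m' : ∀ j, Fin ((q j : ℕ))) (w : Fin d → ℂ) (_ : ∀ j, w j ≠ 0),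
      laurentEval (weightPart (fun j => (σ j : ℤ)) h c)
        (fun j => (η m' j / η m j * w j) ^ (σ j : ℤ)) =
      laurentEval (weightPart (fun j => (σ j : ℤ)) h c) (fun j => w j ^ (σ j : ℤ)) := by
    intro c h hsymm hmax m m' w hw
    have hη : ∀ j, (η m' j / η m j * w j) ^ (σ j : ℤ) =
        rho (q j) (m' j) / rho (q j) (m j) * w j ^ (σ j : ℤ) := by
      intro j
      simp only [η, neg_div_neg_eq, ← div_zpow]
      rw [mul_zpow, hσσ]
    simp only [hη]
    refine laurentEval_weightPart_mul (ζ := fun j => rho (q j) (m' j) / rho (q j) (m j))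
      (fun w hw => hsymm _ w (fun j => ?_) hw) hmax _ fun j => zpow_ne_zero _ (hw j)
    rw [div_pow, rho_pow_self, rho_pow_self, div_one]
  refine eq_single_of_mul_eq_prod_linear η 0
    (fun m j => neg_ne_zero.mpr (zpow_ne_zero _ (rho_ne_zero _ _)))
    (fun m m' hmm => eq_of_rho_ratio_eq hd hq σ m m' fun i j => by simpa [η] using hmm i j)
    _ _ (fun j => (σ j : ℤ)) hσ (hrot c h hsymm hmax) (hrot c' h' hsymm' hmax') ?_
  intro w hw
  rw [hfac _ fun j => zpow_ne_zero _ (hw j)]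
  refine Finset.prod_congr rfl fun m _ => ?_
  rw [← Finset.sum_neg_distrib]
  refine Finset.sum_congr rfl fun j _ => ?_
  rw [if_neg (Units.ne_zero (σ j)), mul_zpow, hσσ]
  simp [η]

/-- A factorization of the Floquet determinant, lifted along `w ↦ w ^ q`, is trivial. -/
lemma support_eq_singleton_of_mul_eq_scriptP {d : ℕ} (hd : 3 ≤ d) (q : Fin d → ℕ+)
    (hq : ∀ i j, i ≠ j → Nat.Coprime (q i) (q j)) (V : (Fin d → ℤ) → ℂ) (lam : ℂ)
    (c c' : (Fin d → ℤ) →₀ ℂ)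
    (hP : ∀ w : Fin d → ℂ, (∀ j, w j ≠ 0) →
      laurentEval c w * laurentEval c' w = scriptP q V (fun j => w j ^ (q j : ℕ)) lam)
    (hsymm : ∀ ζ w : Fin d → ℂ, (∀ j, ζ j ^ (q j : ℕ) = 1) → (∀ j, w j ≠ 0) →
      laurentEval c (fun j => ζ j * w j) = laurentEval c w)
    (hsymm' : ∀ ζ w : Fin d → ℂ, (∀ j, ζ j ^ (q j : ℕ) = 1) → (∀ j, w j ≠ 0) →
      laurentEval c' (fun j => ζ j * w j) = laurentEval c' w) :
    (∃ a, c.support = {a}) ∨ (∃ a, c'.support = {a}) := by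
  have : NeZero d := ⟨by omega⟩
  have hne : c ≠ 0 ∧ c' ≠ 0 := by
    by_contra hcon
    have hzero : ∀ w : Fin d → ℂ, (∀ j, w j ≠ 0) →
        scriptP q V (fun j => w j ^ (q j : ℕ)) lam = 0 := by
      intro w hw
      rw [← hP w hw]
      rcases not_and_or.mp hcon with h | h <;> simp [not_not.mp h, laurentEval]
    obtain ⟨w, hw, hw'⟩ := exists_sum_zpow_ne_zero (1 : Fin d → ℤˣ)
    have hlim := tendsto_scriptP_scale q V lam 1 (by simp) w hw
    have h0 := tendsto_nhds_unique (hlim.congr' (f₂ := fun _ => 0) (by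
      filter_upwards [self_mem_nhdsWithin] with s hs
      rw [hzero _ fun j => mul_ne_zero (zpow_ne_zero _ hs) (hw j), mul_zero]))
      tendsto_const_nhds
    refine Finset.prod_ne_zero_iff.mpr (fun m _ => neg_ne_zero.mpr ?_) h0
    simpa using hw' (fun j => rho (q j) (m j)) fun j => norm_rho _ _
  obtain ⟨hc, hc'⟩ := hne
  choose u hu v hv huv humax hvmax using exists_vertex_decomposition q V lam hc hc' hP
  have hQ : (Fintype.card (∀ j, Fin ((q j : ℕ))) : ℤ) ≠ 0 := by
    have : ∀ j, NeZero (q j : ℕ) := fun j => ⟨(q j).ne_zero⟩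
    exact_mod_cast Fintype.card_ne_zero
  have single_of_const : ∀ (c : (Fin d → ℤ) →₀ ℂ) (u : Fin d → ℤˣ → Fin d → ℤ) (_ : c ≠ 0)
      (_ : ∀ i (s : ℤˣ), ∀ a ∈ c.support, (s : ℤ) * a i ≤ s * u i s i)
      (_ : ∃ a, ∀ i s, u i s = a), ∃ a, c.support = {a} := by
    rintro c u hc hmax ⟨a, ha⟩
    refine ⟨a, (Finset.Nonempty.subset_singleton_iff
      (Finsupp.support_nonempty_iff.mpr hc)).mp fun b hb => Finset.mem_singleton.mpr ?_⟩
    funext i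
    have h1 := hmax i 1 b hb
    have h2 := hmax i (-1) b hb
    rw [ha] at h1 h2
    simp only [Units.val_one, Units.val_neg, one_mul, neg_mul] at h1 h2
    omega
  refine (eq_of_constant_on_orthants hd u v ?_ fun σ => ?_).imp
    (single_of_const c u hc humax) (single_of_const c' v hc' hvmax)
  · intro i j s t hij h
    rw [huv, huv] at h
    have := congrFun h i
    rw [Pi.single_eq_same, Pi.single_eq_of_ne hij] at this
    exact mul_ne_zero (Units.ne_zero s) hQ this
  · obtain ⟨h, h', hsum, hmax, hmax', hsingle⟩ :=
      exists_facet_single (by omega) q hq V lam hc hc' hP hsymm hsymm' σ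
    have hdot : ∀ i, (fun j => (σ j : ℤ)) ⬝ᵥ u i (σ i) + (fun j => (σ j : ℤ)) ⬝ᵥ v i (σ i) =
        h + h' := by
      intro i
      rw [← dotProduct_add, huv, dotProduct_single, hsum, ← mul_assoc, ← Units.val_mul,
        Int.units_mul_self, Units.val_one, one_mul]
    have hmem : ∀ i, u i (σ i) ∈ (weightPart (fun j => (σ j : ℤ)) h c).support := fun i =>
      mem_support_weightPart.mpr ⟨hu i _, by
        linarith [hdot i, hmax _ (hu i (σ i)), hmax' _ (hv i (σ i))]⟩
    have hmem' : ∀ i, v i (σ i) ∈ (weightPart (fun j => (σ j : ℤ)) h' c').support := fun i =>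
      mem_support_weightPart.mpr ⟨hv i _, by
        linarith [hdot i, hmax _ (hu i (σ i)), hmax' _ (hv i (σ i))]⟩
    refine hsingle.imp ?_ ?_
    · rintro ⟨a, C, ha⟩ i j
      rw [ha] at hmem
      have h1 := fun i => Finset.mem_singleton.mp (Finsupp.support_single_subset (hmem i))
      rw [h1, h1]
    · rintro ⟨a, C, ha⟩ i j
      rw [ha] at hmem'
      have h1 := fun i => Finset.mem_singleton.mp (Finsupp.support_single_subset (hmem' i))
      rw [h1, h1]

lemma laurentEval_mapDomain_mul {d : ℕ} (q : Fin d → ℕ+) (c : (Fin d → ℤ) →₀ ℂ)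
    (w : Fin d → ℂ) :
    laurentEval (c.mapDomain fun a j => ((q j : ℕ) : ℤ) * a j) w =
      laurentEval c fun j => w j ^ (q j : ℕ) := by
  rw [laurentEval, Finsupp.sum_mapDomain_index (by simp) (by simp [add_mul]), laurentEval]
  simp only [zpow_mul, zpow_natCast]

lemma isMonomial_of_support_mapDomain {d : ℕ} (q : Fin d → ℕ+) {f : (Fin d → ℂ) → ℂ}
    {c : (Fin d → ℤ) →₀ ℂ}
    (hf : ∀ z : Fin d → ℂ, (∀ j, z j ≠ 0) → f z = laurentEval c z)
    (h : ∃ a, (c.mapDomain fun a j => ((q j : ℕ) : ℤ) * a j).support = {a}) :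
    IsMonomial f := by
  classical
  have hinj : Function.Injective fun (a : Fin d → ℤ) j => ((q j : ℕ) : ℤ) * a j := by
    intro a b hab
    funext j
    exact mul_left_cancel₀ (by exact_mod_cast (q j).ne_zero) (congrFun hab j)
  rw [Finsupp.mapDomain_support_of_injective hinj, ← Finset.card_eq_one,
    Finset.card_image_of_injective _ hinj, Finsupp.card_support_eq_one] at h
  obtain ⟨b, hb, hcb⟩ := h
  refine ⟨c b, b, hb, fun z hz => ?_⟩
  rw [hf z hz, hcb, laurentEval, Finsupp.sum_single_index (by simp)]
  simp

/-- Let `d ≥ 3` and `V : ℤ^d → ℂ` be `Γ`-periodic.  Then for every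
`λ ∈ ℂ` the Laurent polynomial `z ↦ 𝒫_V(z, λ)` is irreducible. -/
theorem statement2 (d : ℕ) (hd : 3 ≤ d) (q : Fin d → ℕ+)
    (hq : ∀ i j, i ≠ j → Nat.Coprime (q i) (q j))
    (V : (Fin d → ℤ) → ℂ) (hV : IsPeriodic q V) (lam : ℂ) :
    LaurentIrreducible (fun z => scriptP q V z lam) := by
  rintro ⟨f, g, ⟨c, hf⟩, ⟨c', hg⟩, hnf, hng, hfg⟩
  have hsymm : ∀ (c : (Fin d → ℤ) →₀ ℂ) (ζ w : Fin d → ℂ), (∀ j, ζ j ^ (q j : ℕ) = 1) →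
      (∀ j, w j ≠ 0) →
      laurentEval (c.mapDomain fun a j => ((q j : ℕ) : ℤ) * a j) (fun j => ζ j * w j) =
        laurentEval (c.mapDomain fun a j => ((q j : ℕ) : ℤ) * a j) w := by
    intro c ζ w hζ _
    simp only [laurentEval_mapDomain_mul, mul_pow, hζ, one_mul]
  rcases support_eq_singleton_of_mul_eq_scriptP hd q hq V lam _ _ (fun w hw => by
    have hw' : ∀ j, w j ^ (q j : ℕ) ≠ 0 := fun j => pow_ne_zero _ (hw j)
    have h := hfg _ hw'
    rw [hf _ hw', hg _ hw'] at h
    rw [laurentEval_mapDomain_mul, laurentEval_mapDomain_mul]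
    exact h.symm) (hsymm c) (hsymm c') with h | h
  · exact hnf (isMonomial_of_support_mapDomain q hf h)
  · exact hng (isMonomial_of_support_mapDomain q hg h)

end
end

section
/- Let d=2 and let V:ℤ^2→ℂ be Γ-periodic. Then for every λ∈ℂ with λ≠[V], the Laurent polynomial z↦𝒫_V(z,λ) in the variables z_1,z_2 is irreducible. Moreover, if 𝒫_V(z,[V]) is reducible, then 𝒫_V(z,[V]) has exactly two non-monomial irreducible factors, counted with multiplicity. -/
noncomputable section

/-- The character `z ↦ z₁^{a₁} z₂^{a₂}` as a homomorphism in the exponent. -/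
def monomialHom (z : Fin 2 → ℂˣ) : Multiplicative (Fin 2 → ℤ) →* ℂ where
  toFun a := ∏ j, (z j : ℂ) ^ (a.toAdd j)
  map_one' := by simp
  map_mul' a b := by
    simp only [toAdd_mul, Pi.add_apply, ← Finset.prod_mul_distrib]
    exact Finset.prod_congr rfl fun j _ => zpow_add₀ (z j).ne_zero _ _

/-- The ring of Laurent polynomials in two variables. -/
abbrev LaurentRing := AddMonoidAlgebra ℂ (Fin 2 → ℤ)

/-- Evaluation of a Laurent polynomial at a point of the torus. -/
def evalTorus (z : Fin 2 → ℂˣ) : LaurentRing →ₐ[ℂ] ℂ :=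
  AddMonoidAlgebra.lift ℂ ℂ _ (monomialHom z)

lemma evalTorus_apply (z : Fin 2 → ℂˣ) (f : LaurentRing) :
    evalTorus z f = f.coeff.sum fun a C => C * ∏ j, (z j : ℂ) ^ a j := by
  simp [evalTorus, AddMonoidAlgebra.lift_apply, monomialHom]

lemma evalTorus_single (z : Fin 2 → ℂˣ) (a : Fin 2 → ℤ) (C : ℂ) :
    evalTorus z (AddMonoidAlgebra.single a C) = C * ∏ j, (z j : ℂ) ^ a j := by
  simp [evalTorus, monomialHom]

/-- The monomial `z ↦ z^a` as a character of the torus. -/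
def torusChar (a : Fin 2 → ℤ) : (Fin 2 → ℂˣ) →* ℂ where
  toFun z := ∏ j, (z j : ℂ) ^ a j
  map_one' := by simp
  map_mul' z w := by simp [mul_zpow]; ring

lemma torusChar_injective : Function.Injective torusChar := by
  intro a b h
  funext i
  have h2 : (2 : ℂ) ≠ 0 := two_ne_zero
  have := DFunLike.congr_fun h (Function.update (1 : Fin 2 → ℂˣ) i (Units.mk0 2 h2))
  have key : ∀ c : Fin 2 → ℤ,
      torusChar c (Function.update (1 : Fin 2 → ℂˣ) i (Units.mk0 2 h2)) = (2 : ℂ) ^ c i := by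
    intro c
    simp only [torusChar, MonoidHom.coe_mk, OneHom.coe_mk]
    rw [Finset.prod_eq_single i]
    · simp
    · intro j _ hj
      simp [hj]
    · simp
  rw [key, key] at this
  have h3 : ((2 : ℝ) : ℂ) ^ a i = ((2 : ℝ) : ℂ) ^ b i := by simpa using this
  have h4 : (2 : ℝ) ^ a i = (2 : ℝ) ^ b i := by exact_mod_cast h3
  exact zpow_right_injective₀ (by norm_num) (by norm_num) h4

lemma evalTorus_injective {f g : LaurentRing} (h : ∀ z, evalTorus z f = evalTorus z g) :
    f = g := by
  have hli := (linearIndependent_monoidHom (Fin 2 → ℂˣ) ℂ).comp _ torusChar_injective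
  rw [linearIndependent_iff_injective_finsuppLinearCombination] at hli
  apply AddMonoidAlgebra.coeff_injective
  apply hli
  funext z
  have hz := h z
  rw [evalTorus_apply, evalTorus_apply] at hz
  simpa [Finsupp.linearCombination_apply, Finsupp.sum, torusChar] using hz

lemma IsLaurent.exists_evalTorus {f : (Fin 2 → ℂ) → ℂ} (hf : IsLaurent f) :
    ∃ p : LaurentRing, ∀ z : Fin 2 → ℂˣ, f (fun j => z j) = evalTorus z p := by
  obtain ⟨c, hc⟩ := hf
  exact ⟨.ofCoeff c, fun z => by rw [evalTorus_apply, hc _ fun j => (z j).ne_zero]⟩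

/-- The largest value of the additive weight `ℓ` on the support of `f`. -/
def topWeight (ℓ : (Fin 2 → ℤ) →+ ℤ) (f : LaurentRing) : ℤ :=
  if h : f.coeff.support.Nonempty then f.coeff.support.sup' h ℓ else 0

lemma support_nonempty {f : LaurentRing} (hf : f ≠ 0) : f.coeff.support.Nonempty := by
  rw [Finsupp.support_nonempty_iff]
  simpa using hf

lemma le_topWeight (ℓ : (Fin 2 → ℤ) →+ ℤ) {f : LaurentRing} {a : Fin 2 → ℤ}
    (ha : a ∈ f.coeff.support) : ℓ a ≤ topWeight ℓ f := by
  rw [topWeight, dif_pos ⟨a, ha⟩]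
  exact Finset.le_sup' ℓ ha

lemma exists_eq_topWeight (ℓ : (Fin 2 → ℤ) →+ ℤ) {f : LaurentRing} (hf : f ≠ 0) :
    ∃ a ∈ f.coeff.support, ℓ a = topWeight ℓ f := by
  rw [topWeight, dif_pos (support_nonempty hf)]
  obtain ⟨a, ha, h⟩ := Finset.exists_mem_eq_sup' (support_nonempty hf) ℓ
  exact ⟨a, ha, h.symm⟩

lemma topWeight_eq {ℓ : (Fin 2 → ℤ) →+ ℤ} {f : LaurentRing} {a : Fin 2 → ℤ}
    (ha : a ∈ f.coeff.support) (h : ∀ b ∈ f.coeff.support, ℓ b ≤ ℓ a) :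
    topWeight ℓ f = ℓ a := by
  refine le_antisymm ?_ (le_topWeight ℓ ha)
  rw [topWeight, dif_pos ⟨a, ha⟩]
  exact Finset.sup'_le _ _ h

lemma exists_add_of_mem_support_mul {f g : LaurentRing} {x : Fin 2 → ℤ}
    (hx : x ∈ (f * g).coeff.support) :
    ∃ y ∈ f.coeff.support, ∃ z ∈ g.coeff.support, y + z = x := by
  classical
  exact Finset.mem_add.mp (AddMonoidAlgebra.support_coeff_mul_subset f g hx)

lemma topWeight_mul (ℓ : (Fin 2 → ℤ) →+ ℤ) {f g : LaurentRing} (hf : f ≠ 0) (hg : g ≠ 0) :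
    topWeight ℓ (f * g) = topWeight ℓ f + topWeight ℓ g := by
  classical
  obtain ⟨a, ha, haf⟩ := exists_eq_topWeight ℓ hf
  obtain ⟨b, hb, hbg⟩ := exists_eq_topWeight ℓ hg
  set A := f.coeff.support.filter (fun y => ℓ y = topWeight ℓ f) with hA
  set B := g.coeff.support.filter (fun y => ℓ y = topWeight ℓ g) with hB
  obtain ⟨y, hy, z, hz, hu⟩ := UniqueSums.uniqueAdd_of_nonempty (A := A) (B := B)
    ⟨a, Finset.mem_filter.2 ⟨ha, haf⟩⟩ ⟨b, Finset.mem_filter.2 ⟨hb, hbg⟩⟩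
  obtain ⟨hy, hyf⟩ := Finset.mem_filter.1 hy
  obtain ⟨hz, hzg⟩ := Finset.mem_filter.1 hz
  have huniq : UniqueAdd f.coeff.support g.coeff.support y z := by
    intro y' z' hy' hz' heq
    have h1 := le_topWeight ℓ hy'
    have h2 := le_topWeight ℓ hz'
    have h3 : ℓ y' + ℓ z' = ℓ y + ℓ z := by rw [← map_add, heq, map_add]
    exact hu (Finset.mem_filter.2 ⟨hy', by omega⟩) (Finset.mem_filter.2 ⟨hz', by omega⟩) heq
  have hmem : y + z ∈ (f * g).coeff.support := by
    rw [Finsupp.mem_support_iff, AddMonoidAlgebra.coeff_mul_add_of_uniqueAdd huniq]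
    exact mul_ne_zero (Finsupp.mem_support_iff.1 hy) (Finsupp.mem_support_iff.1 hz)
  rw [topWeight_eq hmem, map_add, hyf, hzg]
  intro x hx
  obtain ⟨y', hy', z', hz', rfl⟩ := exists_add_of_mem_support_mul hx
  rw [map_add, map_add, hyf, hzg]
  exact add_le_add (le_topWeight ℓ hy') (le_topWeight ℓ hz')

lemma exists_vertex_of_mul {f g : LaurentRing} (hf : f ≠ 0) (hg : g ≠ 0) {x : Fin 2 → ℤ}
    (hx : x ∈ (f * g).coeff.support) :
    ∃ y ∈ f.coeff.support, ∀ ℓ : (Fin 2 → ℤ) →+ ℤ,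
      ℓ x = topWeight ℓ (f * g) → ℓ y = topWeight ℓ f := by
  obtain ⟨y, hy, z, hz, rfl⟩ := exists_add_of_mem_support_mul hx
  refine ⟨y, hy, fun ℓ h => ?_⟩
  rw [topWeight_mul ℓ hf hg, map_add] at h
  have h1 := le_topWeight ℓ hy
  have h2 := le_topWeight ℓ hz
  omega

/-- The weight `a ↦ c m a₁ + d n a₂` on exponents. -/
def diagWeight (m n : ℕ) (c d : ℤ) : (Fin 2 → ℤ) →+ ℤ where
  toFun a := c * (m * a 0) + d * (n * a 1)
  map_zero' := by simp
  map_add' a b := by simp; ring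

lemma diagWeight_apply (m n : ℕ) (c d : ℤ) (a : Fin 2 → ℤ) :
    diagWeight m n c d a = c * (m * a 0) + d * (n * a 1) := rfl

/-- The Newton polygon of `p` is the diamond with vertices `(±n, 0)` and `(0, ±m)`. -/
structure HasDiamond (m n : ℕ) (p : LaurentRing) : Prop where
  le : ∀ a ∈ p.coeff.support, ∀ c d : ℤ, (c = 1 ∨ c = -1) → (d = 1 ∨ d = -1) →
    diagWeight m n c d a ≤ m * n
  right : ![(n : ℤ), 0] ∈ p.coeff.support
  left : ![-(n : ℤ), 0] ∈ p.coeff.support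
  up : ![0, (m : ℤ)] ∈ p.coeff.support
  down : ![0, -(m : ℤ)] ∈ p.coeff.support

/-- The width of the support of `f` in the direction `(m, n)`. -/
def widthSum (m n : ℕ) (f : LaurentRing) : ℤ :=
  topWeight (diagWeight m n 1 1) f + topWeight (diagWeight m n (-1) (-1)) f

/-- The width of the support of `f` in the direction `(m, -n)`. -/
def widthDiff (m n : ℕ) (f : LaurentRing) : ℤ :=
  topWeight (diagWeight m n 1 (-1)) f + topWeight (diagWeight m n (-1) 1) f

section Newton

variable {m n : ℕ} {p f g : LaurentRing}

lemma HasDiamond.topWeight_eq_mul (hp : HasDiamond m n p) {c d : ℤ} (hc : c = 1 ∨ c = -1)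
    (hd : d = 1 ∨ d = -1) : topWeight (diagWeight m n c d) p = m * n := by
  obtain ⟨a, ha, h⟩ : ∃ a ∈ p.coeff.support, diagWeight m n c d a = m * n := by
    rcases hc with rfl | rfl
    · exact ⟨_, hp.right, by simp [diagWeight_apply]⟩
    · exact ⟨_, hp.left, by simp [diagWeight_apply]⟩
  rw [topWeight_eq ha, h]
  intro b hb
  rw [h]
  exact hp.le b hb c d hc hd

lemma HasDiamond.widthSum_eq (hp : HasDiamond m n p) : widthSum m n p = 2 * (m * n) := by
  rw [widthSum, hp.topWeight_eq_mul (by simp) (by simp), hp.topWeight_eq_mul (by simp) (by simp)]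
  ring

lemma HasDiamond.widthDiff_eq (hp : HasDiamond m n p) : widthDiff m n p = 2 * (m * n) := by
  rw [widthDiff, hp.topWeight_eq_mul (by simp) (by simp), hp.topWeight_eq_mul (by simp) (by simp)]
  ring

lemma HasDiamond.ne_zero (hp : HasDiamond m n p) : p ≠ 0 := by
  rintro rfl
  simpa using hp.right

lemma widthSum_mul (hf : f ≠ 0) (hg : g ≠ 0) :
    widthSum m n (f * g) = widthSum m n f + widthSum m n g := by
  simp only [widthSum, topWeight_mul _ hf hg]; ring

lemma widthDiff_mul (hf : f ≠ 0) (hg : g ≠ 0) :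
    widthDiff m n (f * g) = widthDiff m n f + widthDiff m n g := by
  simp only [widthDiff, topWeight_mul _ hf hg]; ring

lemma widthSum_nonneg (hf : f ≠ 0) : 0 ≤ widthSum m n f := by
  obtain ⟨a, ha⟩ := support_nonempty hf
  have h1 := le_topWeight (diagWeight m n 1 1) ha
  have h2 := le_topWeight (diagWeight m n (-1) (-1)) ha
  simp only [diagWeight_apply] at h1 h2
  rw [widthSum]; linarith

lemma widthDiff_nonneg (hf : f ≠ 0) : 0 ≤ widthDiff m n f := by
  obtain ⟨a, ha⟩ := support_nonempty hf
  have h1 := le_topWeight (diagWeight m n 1 (-1)) ha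
  have h2 := le_topWeight (diagWeight m n (-1) 1) ha
  simp only [diagWeight_apply] at h1 h2
  rw [widthDiff]; linarith

lemma exists_mul_of_coprime (hm : 0 < m) (hmn : Nat.Coprime m n) {u v : ℤ}
    (h : m * u = n * v) : ∃ k : ℤ, u = n * k ∧ v = m * k := by
  have hco : IsCoprime (m : ℤ) (n : ℤ) := Nat.isCoprime_iff_coprime.2 hmn
  obtain ⟨k, rfl⟩ : (m : ℤ) ∣ v := hco.dvd_of_dvd_mul_left ⟨u, h.symm⟩
  refine ⟨k, ?_, rfl⟩
  have hm' : (m : ℤ) ≠ 0 := by exact_mod_cast hm.ne'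
  apply mul_left_cancel₀ hm'
  rw [h]; ring

lemma HasDiamond.dvd_widthSum (hm : 0 < m) (hmn : Nat.Coprime m n)
    (hp : HasDiamond m n (f * g)) : 2 * (m * n : ℤ) ∣ widthSum m n f := by
  have hf := left_ne_zero_of_mul hp.ne_zero
  have hg := right_ne_zero_of_mul hp.ne_zero
  obtain ⟨y, -, hy⟩ := exists_vertex_of_mul hf hg hp.up
  obtain ⟨y', -, hy'⟩ := exists_vertex_of_mul hf hg hp.left
  have h1 := hy (diagWeight m n 1 1) (by rw [hp.topWeight_eq_mul] <;> simp [diagWeight_apply]; ring)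
  have h2 := hy (diagWeight m n (-1) 1) (by rw [hp.topWeight_eq_mul] <;> simp [diagWeight_apply]; ring)
  have h3 := hy' (diagWeight m n (-1) (-1)) (by rw [hp.topWeight_eq_mul] <;> simp [diagWeight_apply])
  have h4 := hy' (diagWeight m n (-1) 1) (by rw [hp.topWeight_eq_mul] <;> simp [diagWeight_apply])
  have h5 := h2.trans h4.symm
  rw [widthSum, ← h1, ← h3]
  simp only [diagWeight_apply] at h5 ⊢
  obtain ⟨k, hk, hk'⟩ := exists_mul_of_coprime hm hmn
    (u := y 0 - y' 0) (v := y 1 - y' 1) (by linarith)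
  exact ⟨k, by linear_combination (m : ℤ) * hk + n * hk'⟩

lemma HasDiamond.dvd_widthDiff (hm : 0 < m) (hmn : Nat.Coprime m n)
    (hp : HasDiamond m n (f * g)) : 2 * (m * n : ℤ) ∣ widthDiff m n f := by
  have hf := left_ne_zero_of_mul hp.ne_zero
  have hg := right_ne_zero_of_mul hp.ne_zero
  obtain ⟨y, -, hy⟩ := exists_vertex_of_mul hf hg hp.right
  obtain ⟨y', -, hy'⟩ := exists_vertex_of_mul hf hg hp.up
  have h1 := hy (diagWeight m n 1 1) (by rw [hp.topWeight_eq_mul] <;> simp [diagWeight_apply])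
  have h2 := hy (diagWeight m n 1 (-1)) (by rw [hp.topWeight_eq_mul] <;> simp [diagWeight_apply])
  have h3 := hy' (diagWeight m n (-1) 1) (by rw [hp.topWeight_eq_mul] <;> simp [diagWeight_apply]; ring)
  have h4 := hy' (diagWeight m n 1 1) (by rw [hp.topWeight_eq_mul] <;> simp [diagWeight_apply]; ring)
  have h5 := h1.trans h4.symm
  rw [widthDiff, ← h2, ← h3]
  simp only [diagWeight_apply] at h5 ⊢
  obtain ⟨k, hk, hk'⟩ := exists_mul_of_coprime hm hmn
    (u := y 0 - y' 0) (v := -(y 1 - y' 1)) (by linarith)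
  exact ⟨k, by linear_combination (m : ℤ) * hk + n * hk'⟩

lemma eq_single_of_width_eq_zero (hm : 0 < m) (hn : 0 < n) (hf : f ≠ 0)
    (h1 : widthSum m n f = 0) (h2 : widthDiff m n f = 0) :
    ∃ a C, C ≠ 0 ∧ f = AddMonoidAlgebra.single a C := by
  obtain ⟨a, ha⟩ := support_nonempty hf
  refine ⟨a, f.coeff a, Finsupp.mem_support_iff.1 ha, ?_⟩
  apply AddMonoidAlgebra.coeff_injective
  rw [AddMonoidAlgebra.coeff_single]
  have hsub : f.coeff.support ⊆ {a} := by
    intro b hb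
    have e1 := le_topWeight (diagWeight m n 1 1) ha
    have e2 := le_topWeight (diagWeight m n (-1) (-1)) ha
    have e3 := le_topWeight (diagWeight m n 1 (-1)) ha
    have e4 := le_topWeight (diagWeight m n (-1) 1) ha
    have d1 := le_topWeight (diagWeight m n 1 1) hb
    have d2 := le_topWeight (diagWeight m n (-1) (-1)) hb
    have d3 := le_topWeight (diagWeight m n 1 (-1)) hb
    have d4 := le_topWeight (diagWeight m n (-1) 1) hb
    rw [widthSum] at h1
    rw [widthDiff] at h2
    simp only [diagWeight_apply] at e1 e2 e3 e4 d1 d2 d3 d4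
    have hm' : (m : ℤ) ≠ 0 := by exact_mod_cast hm.ne'
    have hn' : (n : ℤ) ≠ 0 := by exact_mod_cast hn.ne'
    have h0 : b 0 = a 0 := mul_left_cancel₀ hm' (by linarith)
    have h1 : b 1 = a 1 := mul_left_cancel₀ hn' (by linarith)
    rw [Finset.mem_singleton]
    funext i
    fin_cases i
    · exact h0
    · exact h1
  exact (Finsupp.support_subset_singleton.1 hsub)

lemma HasDiamond.le_width (hm : 0 < m) (hn : 0 < n) (hmn : Nat.Coprime m n)
    (hp : HasDiamond m n (f * g)) (hf : ¬ ∃ a C, C ≠ 0 ∧ f = AddMonoidAlgebra.single a C) :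
    2 * (m * n : ℤ) ≤ widthSum m n f + widthDiff m n f := by
  have hf0 := left_ne_zero_of_mul hp.ne_zero
  have h1 := widthSum_nonneg (m := m) (n := n) hf0
  have h2 := widthDiff_nonneg (m := m) (n := n) hf0
  by_contra hlt
  refine hf (eq_single_of_width_eq_zero hm hn hf0 ?_ ?_)
  · exact Int.eq_zero_of_dvd_of_nonneg_of_lt h1 (by linarith) (hp.dvd_widthSum hm hmn)
  · exact Int.eq_zero_of_dvd_of_nonneg_of_lt h2 (by linarith) (hp.dvd_widthDiff hm hmn)

/-- On the support of a Laurent polynomial whose Newton polygon is a segment in the direction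
`(n, m)`, the weight `(m, n)` is extremal. -/
lemma eq_or_eq_of_widthDiff_eq_zero (hm : 0 < m) (hmn : Nat.Coprime m n) (hn : 0 < n)
    (hf : f ≠ 0) (h1 : widthSum m n f = 2 * (m * n)) (h2 : widthDiff m n f = 0) {y : Fin 2 → ℤ}
    (hy : y ∈ f.coeff.support) :
    diagWeight m n 1 1 y = topWeight (diagWeight m n 1 1) f ∨
      diagWeight m n (-1) (-1) y = topWeight (diagWeight m n (-1) (-1)) f := by
  obtain ⟨b, hb, hbt⟩ := exists_eq_topWeight (diagWeight m n (-1) (-1)) hf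
  have e1 := le_topWeight (diagWeight m n 1 1) hy
  have e2 := le_topWeight (diagWeight m n (-1) (-1)) hy
  have e3 := le_topWeight (diagWeight m n 1 (-1)) hy
  have e4 := le_topWeight (diagWeight m n (-1) 1) hy
  have d3 := le_topWeight (diagWeight m n 1 (-1)) hb
  have d4 := le_topWeight (diagWeight m n (-1) 1) hb
  rw [widthSum] at h1
  rw [widthDiff] at h2
  simp only [diagWeight_apply] at *
  obtain ⟨k, hk, hk'⟩ := exists_mul_of_coprime hm hmn
    (u := y 0 - b 0) (v := y 1 - b 1) (by linarith)
  have hk2 : (m : ℤ) * y 0 + n * y 1 - (m * b 0 + n * b 1) = 2 * (m * n) * k := by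
    linear_combination (m : ℤ) * hk + n * hk'
  have hpos : (0 : ℤ) < 2 * (m * n) := by positivity
  have hk0 : 0 ≤ k := by
    by_contra hneg
    nlinarith
  have hk1 : k ≤ 1 := by
    by_contra hneg
    nlinarith
  obtain rfl | rfl : k = 0 ∨ k = 1 := by omega
  · right; linarith
  · left; linarith

/-- On the support of a Laurent polynomial whose Newton polygon is a segment in the direction
`(n, -m)`, the weight `(m, -n)` is extremal. -/
lemma eq_or_eq_of_widthSum_eq_zero (hm : 0 < m) (hmn : Nat.Coprime m n) (hn : 0 < n)
    (hf : f ≠ 0) (h1 : widthDiff m n f = 2 * (m * n)) (h2 : widthSum m n f = 0) {y : Fin 2 → ℤ}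
    (hy : y ∈ f.coeff.support) :
    diagWeight m n 1 (-1) y = topWeight (diagWeight m n 1 (-1)) f ∨
      diagWeight m n (-1) 1 y = topWeight (diagWeight m n (-1) 1) f := by
  obtain ⟨b, hb, hbt⟩ := exists_eq_topWeight (diagWeight m n (-1) 1) hf
  have e1 := le_topWeight (diagWeight m n 1 (-1)) hy
  have e2 := le_topWeight (diagWeight m n (-1) 1) hy
  have e3 := le_topWeight (diagWeight m n 1 1) hy
  have e4 := le_topWeight (diagWeight m n (-1) (-1)) hy
  have d3 := le_topWeight (diagWeight m n 1 1) hb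
  have d4 := le_topWeight (diagWeight m n (-1) (-1)) hb
  rw [widthDiff] at h1
  rw [widthSum] at h2
  simp only [diagWeight_apply] at *
  obtain ⟨k, hk, hk'⟩ := exists_mul_of_coprime hm hmn
    (u := y 0 - b 0) (v := -(y 1 - b 1)) (by linarith)
  have hk2 : (m : ℤ) * y 0 - n * y 1 - (m * b 0 - n * b 1) = 2 * (m * n) * k := by
    linear_combination (m : ℤ) * hk + n * hk'
  have hpos : (0 : ℤ) < 2 * (m * n) := by positivity
  have hk0 : 0 ≤ k := by
    by_contra hneg
    nlinarith
  have hk1 : k ≤ 1 := by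
    by_contra hneg
    nlinarith
  obtain rfl | rfl : k = 0 ∨ k = 1 := by omega
  · right; linarith
  · left; linarith

/-- The exponents of the four vertices `(±n, 0)`, `(0, ±m)` of the diamond. -/
def IsDiamondCorner (m n : ℕ) (a : Fin 2 → ℤ) : Prop :=
  (diagWeight m n 1 1 a = m * n ∨ diagWeight m n 1 1 a = -(m * n)) ∧
    (diagWeight m n 1 (-1) a = m * n ∨ diagWeight m n 1 (-1) a = -(m * n))

lemma HasDiamond.isCorner_of_segments (hm : 0 < m) (hn : 0 < n) (hmn : Nat.Coprime m n)
    (hp : HasDiamond m n (f * g)) (hf : widthDiff m n f = 0)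
    (hg : widthSum m n g = 0) {x : Fin 2 → ℤ} (hx : x ∈ (f * g).coeff.support) :
    IsDiamondCorner m n x := by
  have hf0 := left_ne_zero_of_mul hp.ne_zero
  have hg0 := right_ne_zero_of_mul hp.ne_zero
  have hS := hp.widthSum_eq
  have hD := hp.widthDiff_eq
  rw [widthSum_mul hf0 hg0, hg, add_zero] at hS
  rw [widthDiff_mul hf0 hg0, hf, zero_add] at hD
  obtain ⟨y, hy, z, hz, rfl⟩ := exists_add_of_mem_support_mul hx
  have c1 := eq_or_eq_of_widthDiff_eq_zero hm hmn hn hf0 hS hf hy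
  have c2 := eq_or_eq_of_widthSum_eq_zero hm hmn hn hg0 hD hg hz
  have t1 := hp.topWeight_eq_mul (c := 1) (d := 1) (by simp) (by simp)
  have t2 := hp.topWeight_eq_mul (c := -1) (d := -1) (by simp) (by simp)
  have t3 := hp.topWeight_eq_mul (c := 1) (d := -1) (by simp) (by simp)
  have t4 := hp.topWeight_eq_mul (c := -1) (d := 1) (by simp) (by simp)
  rw [topWeight_mul _ hf0 hg0] at t1 t2 t3 t4
  have e1 := le_topWeight (diagWeight m n 1 1) hz
  have e2 := le_topWeight (diagWeight m n (-1) (-1)) hz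
  have e3 := le_topWeight (diagWeight m n 1 (-1)) hy
  have e4 := le_topWeight (diagWeight m n (-1) 1) hy
  rw [widthDiff] at hf
  rw [widthSum] at hg
  simp only [IsDiamondCorner, diagWeight_apply, Pi.add_apply] at *
  constructor
  · rcases c1 with c | c
    · left; linarith
    · right; linarith
  · rcases c2 with c | c
    · left; linarith
    · right; linarith

/-- A product of two non-monomials with Newton polygon the diamond has exactly four terms. -/
lemma HasDiamond.isCorner (hm : 0 < m) (hn : 0 < n) (hmn : Nat.Coprime m n)
    (hp : HasDiamond m n (f * g)) (hf : ¬ ∃ a C, C ≠ 0 ∧ f = AddMonoidAlgebra.single a C)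
    (hg : ¬ ∃ a C, C ≠ 0 ∧ g = AddMonoidAlgebra.single a C) {x : Fin 2 → ℤ}
    (hx : x ∈ (f * g).coeff.support) : IsDiamondCorner m n x := by
  have hp' : HasDiamond m n (g * f) := mul_comm f g ▸ hp
  have hf0 := left_ne_zero_of_mul hp.ne_zero
  have hg0 := right_ne_zero_of_mul hp.ne_zero
  have hS := hp.widthSum_eq
  have hD := hp.widthDiff_eq
  rw [widthSum_mul hf0 hg0] at hS
  rw [widthDiff_mul hf0 hg0] at hD
  have h1 := hp.le_width hm hn hmn hf
  have h2 := hp'.le_width hm hn hmn hg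
  have hpos : (0 : ℤ) < 2 * (m * n) := by positivity
  obtain ⟨k, hk⟩ := hp.dvd_widthSum hm hmn
  have n1 := widthSum_nonneg (m := m) (n := n) hf0
  have n2 := widthSum_nonneg (m := m) (n := n) hg0
  have hk0 : 0 ≤ k := by
    by_contra hneg
    nlinarith
  have hk1 : k ≤ 1 := by
    by_contra hneg
    nlinarith
  obtain rfl | rfl : k = 0 ∨ k = 1 := by omega
  · rw [mul_comm] at hx
    exact hp'.isCorner_of_segments hm hn hmn (by linarith) (by linarith) hx
  · exact hp.isCorner_of_segments hm hn hmn (by linarith) (by linarith) hx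

/-- A Laurent polynomial whose Newton polygon is the diamond has at most two non-monomial
factors. -/
lemma HasDiamond.card_le_two (hm : 0 < m) (hn : 0 < n) (hmn : Nat.Coprime m n) {k : ℕ}
    (F : Fin k → LaurentRing) (hp : HasDiamond m n (∏ i, F i))
    (hF : ∀ i, ¬ ∃ a C, C ≠ 0 ∧ F i = AddMonoidAlgebra.single a C) : k ≤ 2 := by
  have hne : ∀ i, F i ≠ 0 := fun i =>
    Finset.prod_ne_zero_iff.1 hp.ne_zero i (Finset.mem_univ i)
  have hone : ∀ ℓ, topWeight ℓ 1 = 0 := fun ℓ => by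
    have := topWeight_mul ℓ (one_ne_zero (α := LaurentRing)) (one_ne_zero (α := LaurentRing))
    rw [mul_one] at this
    omega
  have hsum : ∀ ℓ, topWeight ℓ (∏ i, F i) = ∑ i, topWeight ℓ (F i) := by
    intro ℓ
    have : ∀ s : Finset (Fin k), topWeight ℓ (∏ i ∈ s, F i) = ∑ i ∈ s, topWeight ℓ (F i) := by
      intro s
      induction s using Finset.cons_induction with
      | empty => simpa using hone ℓ
      | cons a s ha ih =>
        rw [Finset.prod_cons, Finset.sum_cons, topWeight_mul ℓ (hne a)
          (Finset.prod_ne_zero_iff.2 fun i _ => hne i), ih]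
    exact this _
  have hS := hp.widthSum_eq
  have hD := hp.widthDiff_eq
  have hle : ∀ i, 2 * (m * n : ℤ) ≤ widthSum m n (F i) + widthDiff m n (F i) := by
    intro i
    have hsplit := Finset.mul_prod_erase Finset.univ F (Finset.mem_univ i)
    rw [← hsplit] at hp
    exact hp.le_width hm hn hmn (hF i)
  have htot : ∑ i, (widthSum m n (F i) + widthDiff m n (F i))
      = 2 * (2 * (m * n)) := by
    simp only [widthSum, widthDiff, hsum] at hS hD ⊢
    simp only [Finset.sum_add_distrib]
    linarith
  have hb := Finset.sum_le_sum fun i (_ : i ∈ Finset.univ) => hle i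
  rw [htot, Finset.sum_const, Finset.card_univ, Fintype.card_fin, nsmul_eq_mul] at hb
  have hpos : (0 : ℤ) < 2 * (m * n) := by positivity
  have := le_of_mul_le_mul_right hb hpos
  exact_mod_cast this

end Newton

/-- The fundamental domain `W`. -/
abbrev Cell (q : Fin 2 → ℕ+) := ∀ j, Fin (q j : ℕ)

section Hopping

variable {q : Fin 2 → ℕ+}

/-- Reduction of a lattice point modulo `Γ`. -/
def wrap (q : Fin 2 → ℕ+) (v : Fin 2 → ℤ) : Cell q := fun j => fem (q j) (v j)

/-- A point of the fundamental domain as a lattice point. -/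
def Cell.toInt (n : Cell q) : Fin 2 → ℤ := fun j => ((n j : ℕ) : ℤ)

/-- The point of the fundamental domain reached from `n` by moving `s` steps in direction `j`. -/
def hop (j : Fin 2) (s : ℤ) (n : Cell q) : Cell q :=
  wrap q (Function.update n.toInt j (n.toInt j + s))

lemma toInt_wrap (v : Fin 2 → ℤ) (j : Fin 2) :
    (wrap q v).toInt j = v j % ((q j : ℕ) : ℤ) := by
  have hq : (0:ℤ) < ((q j : ℕ) : ℤ) := by exact_mod_cast (q j).pos
  simp only [Cell.toInt, wrap, fem]
  exact Int.toNat_of_nonneg (Int.emod_nonneg _ hq.ne')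

lemma toInt_injective : Function.Injective (Cell.toInt (q := q)) := by
  intro n n' h
  funext j
  have := congrFun h j
  simp only [Cell.toInt] at this
  exact Fin.ext (by exact_mod_cast this)

lemma wrap_eq_wrap {v w : Fin 2 → ℤ} :
    wrap q v = wrap q w ↔ ∀ j, v j ≡ w j [ZMOD ((q j : ℕ) : ℤ)] := by
  rw [← toInt_injective.eq_iff, funext_iff]
  simp only [toInt_wrap, Int.ModEq]

lemma wrap_toInt (n : Cell q) : wrap q n.toInt = n := by
  apply toInt_injective
  funext j
  rw [toInt_wrap]
  refine Int.emod_eq_of_lt (by simp [Cell.toInt]) ?_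
  simp only [Cell.toInt]
  exact_mod_cast (n j).isLt

lemma hop_wrap (j : Fin 2) (s : ℤ) (v : Fin 2 → ℤ) :
    hop j s (wrap q v) = wrap q (Function.update v j (v j + s)) := by
  rw [hop, wrap_eq_wrap]
  intro i
  rcases eq_or_ne i j with rfl | hij
  · simp only [Function.update_self, toInt_wrap]
    exact (Int.mod_modEq _ _).add_right _
  · simp only [Function.update_of_ne hij, toInt_wrap]
    exact Int.mod_modEq _ _

lemma hop_hop_neg (j : Fin 2) (s : ℤ) (n : Cell q) : hop j s (hop j (-s) n) = n := by
  conv_rhs => rw [← wrap_toInt n]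
  rw [hop, hop, ← hop, hop_wrap]
  simp

/-- Hopping as a permutation of the fundamental domain. -/
def hopEquiv (j : Fin 2) (s : ℤ) : Equiv.Perm (Cell q) where
  toFun := hop j s
  invFun := hop j (-s)
  left_inv n := by simpa using hop_hop_neg j (-s) n
  right_inv n := hop_hop_neg j s n

variable {K : Type*} [CommRing K]

/-- The periodic hopping matrix with hopping amplitude `-c j s` in direction `s e_j`, `s = ±1`,
and diagonal `φ`. -/
def hopMat (c : Fin 2 → ℤ → K) (φ : Cell q → K) : Matrix (Cell q) (Cell q) K := fun n n' =>
  -(∑ j, (c j 1 * (if n' = hop j 1 n then 1 else 0) +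
    c j (-1) * (if n' = hop j (-1) n then 1 else 0))) + φ n * (if n = n' then 1 else 0)

lemma hopMat_mulVec (c : Fin 2 → ℤ → K) (φ : Cell q → K) (u : Cell q → K) (n : Cell q) :
    (hopMat c φ).mulVec u n =
      -(∑ j, (c j 1 * u (hop j 1 n) + c j (-1) * u (hop j (-1) n))) + φ n * u n := by
  simp [Matrix.mulVec, dotProduct, hopMat, add_mul, Finset.sum_add_distrib, Fin.sum_univ_two]

lemma smul_hopMat (k : K) (c : Fin 2 → ℤ → K) (φ : Cell q → K) :
    k • hopMat c φ = hopMat (fun j s => k * c j s) (fun n => k * φ n) := by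
  ext n n'
  simp only [Matrix.smul_apply, smul_eq_mul, hopMat, Fin.sum_univ_two]
  ring

lemma hopMat_map {K' : Type*} [CommRing K'] (h : K →+* K') (c : Fin 2 → ℤ → K)
    (φ : Cell q → K) :
    (hopMat c φ).map h = hopMat (fun j s => h (c j s)) (fun n => h (φ n)) := by
  ext n n'
  simp [hopMat, apply_ite h]

lemma hopMat_congr {c c' : Fin 2 → ℤ → K} (φ : Cell q → K) (h1 : ∀ j, c j 1 = c' j 1)
    (h2 : ∀ j, c j (-1) = c' j (-1)) : hopMat c φ = hopMat c' φ := by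
  ext n n'
  simp [hopMat, h1, h2]

/-- The point `(ζ₁^{q₁}, ζ₂^{q₂})` of the torus. -/
def torusPow (q : Fin 2 → ℕ+) (ζ : Fin 2 → ℂˣ) : Fin 2 → ℂˣ := fun j => ζ j ^ (q j : ℕ)

lemma extendBC_single (ζ : Fin 2 → ℂˣ) (n n' : Cell q) (j : Fin 2) (s : ℤ) :
    extendBC q (fun i => (torusPow q ζ i : ℂ)) (Pi.single n' 1)
        (Function.update n.toInt j (n.toInt j + s)) =
      (∏ i, (ζ i : ℂ) ^ n.toInt i) * ((ζ j : ℂ) ^ s * (if n' = hop j s n then 1 else 0)) *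
        (∏ i, (ζ i : ℂ) ^ n'.toInt i)⁻¹ := by
  set v := Function.update n.toInt j (n.toInt j + s) with hv
  have hw : (fun i => fem (q i) (v i)) = hop j s n := rfl
  rw [extendBC, hw]
  by_cases h : n' = hop j s n
  · subst h
    have hz : ∀ i, (ζ i : ℂ) ≠ 0 := fun i => (ζ i).ne_zero
    have h1 : ∏ i, (ζ i : ℂ) ^ v i = (∏ i, (ζ i : ℂ) ^ n.toInt i) * (ζ j : ℂ) ^ s := by
      have : ∀ i, (ζ i : ℂ) ^ v i
          = (ζ i : ℂ) ^ n.toInt i * (if i = j then (ζ j : ℂ) ^ s else 1) := by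
        intro i
        rcases eq_or_ne i j with rfl | hij
        · simp [hv, zpow_add₀ (hz i)]
        · simp [hv, hij]
      rw [Finset.prod_congr rfl fun i _ => this i, Finset.prod_mul_distrib]
      simp
    simp only [Pi.single_eq_same, if_true, mul_one]
    rw [← h1, ← div_eq_mul_inv, ← Finset.prod_div_distrib]
    refine Finset.prod_congr rfl fun i _ => ?_
    rw [hop, toInt_wrap, ← hv, ← zpow_sub₀ (hz i), torusPow, Units.val_pow_eq_pow_val,
      ← zpow_natCast, ← zpow_mul]
    congr 1
    have := Int.mul_ediv_add_emod (v i) ((q i : ℕ) : ℤ)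
    linarith
  · rw [Pi.single_eq_of_ne (Ne.symm h), if_neg h]
    simp

lemma scriptP_torusPow (V : (Fin 2 → ℤ) → ℂ) (lam : ℂ) (ζ : Fin 2 → ℂˣ) :
    scriptP q V (fun i => (torusPow q ζ i : ℂ)) lam =
      (hopMat (fun j s => (ζ j : ℂ) ^ s) (fun n : Cell q => V n.toInt - lam)).det := by
  set g : Cell q → ℂ := fun n => ∏ i, (ζ i : ℂ) ^ n.toInt i with hg
  have hg0 : ∀ n, g n ≠ 0 := fun n =>
    Finset.prod_ne_zero_iff.2 fun i _ => zpow_ne_zero _ (ζ i).ne_zero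
  have hmat : DVmat q V (fun i => (torusPow q ζ i : ℂ)) - lam • (1 : Matrix (Cell q) (Cell q) ℂ)
      = Matrix.diagonal g * hopMat (fun j s => (ζ j : ℂ) ^ s)
        (fun n : Cell q => V n.toInt - lam) * Matrix.diagonal (fun n => (g n)⁻¹) := by
    refine Matrix.ext fun (n n' : Cell q) => ?_
    rw [Matrix.mul_diagonal, Matrix.diagonal_mul, Matrix.sub_apply, Matrix.smul_apply,
      Matrix.one_apply, DVmat, discLap, hopMat, Fin.sum_univ_two, Fin.sum_univ_two]
    have key := extendBC_single ζ n n'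
    simp only [sub_eq_add_neg]
    have e : ∀ j, ((n j : ℕ) : ℤ) = n.toInt j := fun _ => rfl
    simp only [e, key]
    by_cases h : n = n'
    · subst h
      have hc := hg0 n
      rw [if_pos rfl, smul_eq_mul]
      have hgn : (∏ i, (ζ i : ℂ) ^ n.toInt i) = g n := rfl
      rw [hgn]
      field_simp
      ring
    · rw [if_neg h, smul_eq_mul]
      simp only [hg]
      ring
  rw [scriptP, hmat, Matrix.det_mul, Matrix.det_mul, Matrix.det_diagonal, Matrix.det_diagonal,
    Finset.prod_inv_distrib]
  have : ∏ n, g n ≠ 0 := Finset.prod_ne_zero_iff.2 fun n _ => hg0 n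
  field_simp

end Hopping

section Degree

/-- Laurent polynomials all of whose exponents have weight at most `d`. -/
def weightLE (ℓ : (Fin 2 → ℤ) →+ ℤ) (d : ℤ) : Submodule ℂ LaurentRing where
  carrier := {f | ∀ a ∈ f.coeff.support, ℓ a ≤ d}
  add_mem' {f g} hf hg a ha := by
    classical
    rw [AddMonoidAlgebra.coeff_add] at ha
    rcases Finset.mem_union.1 (Finsupp.support_add ha) with h | h
    · exact hf a h
    · exact hg a h
  zero_mem' := by simp
  smul_mem' c f hf a ha := hf a (Finsupp.support_smul ha)

lemma single_mem_weightLE {ℓ : (Fin 2 → ℤ) →+ ℤ} {d : ℤ} {a : Fin 2 → ℤ} (h : ℓ a ≤ d) (C : ℂ) :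
    AddMonoidAlgebra.single a C ∈ weightLE ℓ d := by
  intro b hb
  rw [AddMonoidAlgebra.coeff_single] at hb
  rw [Finset.mem_singleton.1 (Finsupp.support_single_subset hb)]
  exact h

lemma prod_mem_weightLE {ι : Type*} (ℓ : (Fin 2 → ℤ) →+ ℤ) (s : Finset ι) (f : ι → LaurentRing)
    (h : ∀ i ∈ s, f i ∈ weightLE ℓ 1) : ∏ i ∈ s, f i ∈ weightLE ℓ s.card := by
  induction s using Finset.cons_induction with
  | empty =>
    rw [Finset.prod_empty, AddMonoidAlgebra.one_def]
    exact single_mem_weightLE (by simp) 1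
  | cons a s ha ih =>
    rw [Finset.prod_cons]
    intro x hx
    obtain ⟨y, hy, z, hz, rfl⟩ := exists_add_of_mem_support_mul hx
    have h1 := h a (Finset.mem_cons_self a s) y hy
    have h2 := ih (fun i hi => h i (Finset.mem_cons_of_mem hi)) z hz
    rw [map_add, Finset.card_cons]
    push_cast
    linarith

lemma det_mem_weightLE {ι : Type*} [Fintype ι] [DecidableEq ι] (ℓ : (Fin 2 → ℤ) →+ ℤ)
    (M : Matrix ι ι LaurentRing) (h : ∀ i j, M i j ∈ weightLE ℓ 1) :
    M.det ∈ weightLE ℓ (Fintype.card ι) := by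
  rw [Matrix.det_apply]
  refine Submodule.sum_mem _ fun σ _ => ?_
  have := prod_mem_weightLE ℓ Finset.univ (fun i => M (σ i) i) fun i _ => h _ _
  rcases Int.units_eq_one_or (Equiv.Perm.sign σ) with hs | hs
  · rw [hs, one_smul]; exact this
  · rw [hs, Units.neg_smul, one_smul]; exact Submodule.neg_mem _ this

end Degree

section Fermi

variable {q : Fin 2 → ℕ+} {V : (Fin 2 → ℤ) → ℂ} {lam : ℂ} {p : LaurentRing}

lemma card_cell : Fintype.card (Cell q) = (q 0 : ℕ) * q 1 := by
  simp [Fin.prod_univ_two]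

lemma hopMat_mem_weightLE (ℓ : (Fin 2 → ℤ) →+ ℤ) (h1 : ∀ j, ℓ (Pi.single j 1) ≤ 1)
    (h2 : ∀ j, ℓ (Pi.single j (-1)) ≤ 1) (φ : Cell q → ℂ) (n n' : Cell q) :
    hopMat (fun j s => (AddMonoidAlgebra.single (Pi.single j s) 1 : LaurentRing))
      (fun n => AddMonoidAlgebra.single 0 (φ n)) n n' ∈ weightLE ℓ 1 := by
  have hite : ∀ (f : LaurentRing) (P : Prop) [Decidable P], f ∈ weightLE ℓ 1 →
      f * (if P then 1 else 0) ∈ weightLE ℓ 1 := by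
    intro f P _ hf
    split_ifs
    · simpa using hf
    · simp
  rw [hopMat]
  refine Submodule.add_mem _ (Submodule.neg_mem _ (Submodule.sum_mem _ fun j _ =>
    Submodule.add_mem _ ?_ ?_)) ?_
  · exact hite _ _ (single_mem_weightLE (h1 j) 1)
  · exact hite _ _ (single_mem_weightLE (h2 j) 1)
  · exact hite _ _ (single_mem_weightLE (by simp) _)

lemma weight_le_of_evalTorus_eq
    (hp : ∀ z : Fin 2 → ℂˣ, scriptP q V (fun j => z j) lam = evalTorus z p)
    {a : Fin 2 → ℤ} (ha : a ∈ p.coeff.support) {c d : ℤ} (hc : c = 1 ∨ c = -1)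
    (hd : d = 1 ∨ d = -1) :
    diagWeight (q 0) (q 1) c d a ≤ ((q 0 : ℕ) : ℤ) * ((q 1 : ℕ) : ℤ) := by
  set scale : (Fin 2 → ℤ) → (Fin 2 → ℤ) := fun a j => ((q j : ℕ) : ℤ) * a j with hscale
  have hinj : Function.Injective scale := by
    intro a b h
    funext j
    have hq : ((q j : ℕ) : ℤ) ≠ 0 := by exact_mod_cast (q j).ne_zero
    exact mul_left_cancel₀ hq (congrFun h j)
  have key : (hopMat (fun j s => (AddMonoidAlgebra.single (Pi.single j s) 1 : LaurentRing))
      (fun n : Cell q => AddMonoidAlgebra.single 0 (V n.toInt - lam))).det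
      = AddMonoidAlgebra.ofCoeff (p.coeff.mapDomain scale) := by
    apply evalTorus_injective
    intro ζ
    have h1 := RingHom.map_det (evalTorus ζ : LaurentRing →+* ℂ)
      (hopMat (fun j s => (AddMonoidAlgebra.single (Pi.single j s) 1 : LaurentRing))
      (fun n : Cell q => AddMonoidAlgebra.single 0 (V n.toInt - lam)))
    rw [RingHom.mapMatrix_apply, hopMat_map] at h1
    have h2 : (hopMat (fun j s => (evalTorus ζ : LaurentRing →+* ℂ)
          (AddMonoidAlgebra.single (Pi.single j s) 1))
        (fun n : Cell q => (evalTorus ζ : LaurentRing →+* ℂ)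
          (AddMonoidAlgebra.single 0 (V n.toInt - lam))))
        = hopMat (fun j s => (ζ j : ℂ) ^ s) (fun n : Cell q => V n.toInt - lam) := by
      congr 1
      · funext j s
        rw [RingHom.coe_coe, evalTorus_single, Finset.prod_eq_single j]
        · simp
        · intro i _ hij
          simp [hij]
        · simp
      · funext n
        rw [RingHom.coe_coe, evalTorus_single]
        simp
    rw [h2, ← scriptP_torusPow, hp] at h1
    refine h1.trans ?_
    rw [evalTorus_apply, evalTorus_apply, AddMonoidAlgebra.coeff_ofCoeff,
      Finsupp.sum_mapDomain_index (by simp) (by intros; ring)]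
    simp [torusPow, hscale, zpow_mul]
  have hmem : scale a ∈ (hopMat (fun j s => (AddMonoidAlgebra.single (Pi.single j s) 1 :
      LaurentRing)) (fun n : Cell q => AddMonoidAlgebra.single 0
        (V n.toInt - lam))).det.coeff.support := by
    rw [key, AddMonoidAlgebra.coeff_ofCoeff, Finsupp.mem_support_iff, Finsupp.mapDomain_apply hinj]
    exact Finsupp.mem_support_iff.1 ha
  have hle := det_mem_weightLE (diagWeight 1 1 c d) _
    (hopMat_mem_weightLE (q := q) _ ?_ ?_ _) _ hmem
  · rw [card_cell] at hle
    simpa [diagWeight_apply, hscale] using hle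
  · intro j
    fin_cases j <;> rcases hc with rfl | rfl <;> rcases hd with rfl | rfl <;>
      simp [diagWeight_apply]
  · intro j
    fin_cases j <;> rcases hc with rfl | rfl <;> rcases hd with rfl | rfl <;>
      simp [diagWeight_apply]

lemma eq_of_eqOn_ne_zero {F G : ℂ → ℂ} (hF : Continuous F) (hG : Continuous G)
    (h : ∀ ε, ε ≠ 0 → F ε = G ε) : F 0 = G 0 :=
  congrFun (Continuous.ext_on (dense_compl_singleton (0 : ℂ)) hF hG fun ε hε => h ε hε) 0

lemma continuous_hopMat_apply {c : ℂ → Fin 2 → ℤ → ℂ} {φ : ℂ → Cell q → ℂ}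
    (hc : ∀ j s, Continuous fun ε => c ε j s) (hφ : ∀ n, Continuous fun ε => φ ε n) :
    Continuous fun ε => hopMat (c ε) (φ ε) := by
  refine continuous_matrix fun n n' => ?_
  unfold hopMat
  fun_prop

lemma exists_mem_support_eq
    (hp : ∀ z : Fin 2 → ℂˣ, scriptP q V (fun j => z j) lam = evalTorus z p)
    (j₀ : Fin 2) {s₀ : ℤ} (hs₀ : s₀ = 1 ∨ s₀ = -1) :
    ∃ a ∈ p.coeff.support,
      s₀ * (((q j₀ : ℕ) : ℤ) * a j₀) = ((q 0 : ℕ) : ℤ) * ((q 1 : ℕ) : ℤ) := by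
  set N : ℕ := (q 0 : ℕ) * q 1 with hN
  by_contra! hcon
  have hle : ∀ a ∈ p.coeff.support, s₀ * (((q j₀ : ℕ) : ℤ) * a j₀) ≤ (N : ℤ) := by
    intro a ha
    have h1 := weight_le_of_evalTorus_eq hp ha (c := s₀) (d := s₀) hs₀ hs₀
    have h2 := weight_le_of_evalTorus_eq hp ha (c := s₀) (d := -s₀) hs₀ (by omega)
    have h3 := weight_le_of_evalTorus_eq hp ha (c := -s₀) (d := s₀) (by omega) hs₀
    simp only [diagWeight_apply] at h1 h2 h3
    rw [hN]
    push_cast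
    fin_cases j₀ <;> simp only [Fin.zero_eta, Fin.mk_one] <;> linarith
  set c : ℂ → Fin 2 → ℤ → ℂ := fun ε j s =>
    if j = j₀ then (if s = s₀ then 1 else ε ^ 2) else ε with hc
  set M : ℂ → Matrix (Cell q) (Cell q) ℂ := fun ε =>
    hopMat (c ε) (fun n => ε * (V n.toInt - lam)) with hM
  set S : ℂ → ℂ := fun ε => ∑ a ∈ p.coeff.support,
    p.coeff a * ε ^ ((N : ℤ) - s₀ * (((q j₀ : ℕ) : ℤ) * a j₀)).toNat with hS
  have heq : ∀ ε, ε ≠ 0 → (M ε).det = S ε := by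
    intro ε hε
    set ζ : Fin 2 → ℂˣ := fun j => if j = j₀ then Units.mk0 ε hε ^ (-s₀) else 1 with hζ
    have h1 := scriptP_torusPow (q := q) V lam ζ
    rw [hp] at h1
    have h2 : M ε = ε • hopMat (fun j s => (ζ j : ℂ) ^ s) (fun n : Cell q => V n.toInt - lam) := by
      rw [smul_hopMat, hM]
      apply hopMat_congr
      · intro j
        by_cases hj : j = j₀
        · rcases hs₀ with rfl | rfl <;> simp [hc, hζ, hj, hε, sq]
        · simp [hc, hζ, hj]
      · intro j
        by_cases hj : j = j₀
        · rcases hs₀ with rfl | rfl <;> simp [hc, hζ, hj, hε, sq]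
        · simp [hc, hζ, hj]
    rw [h2, Matrix.det_smul, ← h1, card_cell, ← hN, evalTorus_apply, Finsupp.sum,
      Finset.mul_sum]
    refine Finset.sum_congr rfl fun a ha => ?_
    have h3 : ∏ j, (torusPow q ζ j : ℂ) ^ a j = ε ^ (-(s₀ * (((q j₀ : ℕ) : ℤ) * a j₀))) := by
      rw [Finset.prod_eq_single j₀]
      · simp only [torusPow, hζ, if_true, Units.val_pow_eq_pow_val, Units.val_zpow_eq_zpow_val,
          Units.val_mk0]
        rw [← zpow_natCast, ← zpow_mul, ← zpow_mul]
        congr 1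
        ring
      · intro j _ hj
        simp [torusPow, hζ, hj]
      · simp
    have h4 : ε ^ ((N : ℤ) - s₀ * (((q j₀ : ℕ) : ℤ) * a j₀)).toNat
        = ε ^ N * ε ^ (-(s₀ * (((q j₀ : ℕ) : ℤ) * a j₀))) := by
      rw [← zpow_natCast, Int.toNat_of_nonneg (by linarith [hle a ha]), ← zpow_natCast,
        ← zpow_add₀ hε]
      congr 1
    rw [h3, h4]
    ring
  have hMc : Continuous fun ε => (M ε).det := by
    refine Continuous.matrix_det (continuous_hopMat_apply (fun j s => ?_) fun n => by fun_prop)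
    simp only [hc]
    split_ifs <;> fun_prop
  have hSc : Continuous S := by
    rw [hS]
    fun_prop
  have h0 := eq_of_eqOn_ne_zero hMc hSc heq
  have hS0 : S 0 = 0 := by
    refine Finset.sum_eq_zero fun a ha => ?_
    have := lt_of_le_of_ne (hle a ha) (by rw [hN]; push_cast; exact hcon a ha)
    rw [zero_pow (by omega), mul_zero]
  rw [hS0] at h0
  obtain ⟨u, hu, hMu⟩ := Matrix.exists_mulVec_eq_zero_iff.2 h0
  apply hu
  funext n
  have h1 := congrFun hMu (hop j₀ (-s₀) n)
  rw [hM, hopMat_mulVec] at h1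
  have h2 : u (hop j₀ s₀ (hop j₀ (-s₀) n)) = 0 := by
    generalize hop j₀ (-s₀) n = n' at h1 ⊢
    rcases hs₀ with rfl | rfl <;> fin_cases j₀ <;> simpa [hc] using h1
  rwa [hop_hop_neg] at h2

lemma hasDiamond_of_evalTorus_eq
    (hp : ∀ z : Fin 2 → ℂˣ, scriptP q V (fun j => z j) lam = evalTorus z p) :
    HasDiamond (q 0) (q 1) p := by
  have hq0 : ((q 0 : ℕ) : ℤ) ≠ 0 := by exact_mod_cast (q 0).ne_zero
  have hq1 : ((q 1 : ℕ) : ℤ) ≠ 0 := by exact_mod_cast (q 1).ne_zero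
  have key0 : ∀ s : ℤ, (s = 1 ∨ s = -1) → ![s * ((q 1 : ℕ) : ℤ), 0] ∈ p.coeff.support := by
    intro s hs
    obtain ⟨a, ha, h⟩ := exists_mem_support_eq hp 0 hs
    have h1 := weight_le_of_evalTorus_eq hp ha (c := s) (d := 1) hs (by simp)
    have h2 := weight_le_of_evalTorus_eq hp ha (c := s) (d := -1) hs (by simp)
    simp only [diagWeight_apply] at h1 h2
    have ha1 : a 1 = 0 := mul_left_cancel₀ hq1 (by linarith)
    have ha0 : a 0 = s * ((q 1 : ℕ) : ℤ) := mul_left_cancel₀ hq0 (by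
      rcases hs with rfl | rfl <;> linarith)
    convert ha using 1
    funext i
    fin_cases i <;> simp [ha0, ha1]
  have key1 : ∀ s : ℤ, (s = 1 ∨ s = -1) → ![0, s * ((q 0 : ℕ) : ℤ)] ∈ p.coeff.support := by
    intro s hs
    obtain ⟨a, ha, h⟩ := exists_mem_support_eq hp 1 hs
    have h1 := weight_le_of_evalTorus_eq hp ha (c := 1) (d := s) (by simp) hs
    have h2 := weight_le_of_evalTorus_eq hp ha (c := -1) (d := s) (by simp) hs
    simp only [diagWeight_apply] at h1 h2
    have ha0 : a 0 = 0 := mul_left_cancel₀ hq0 (by linarith)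
    have ha1 : a 1 = s * ((q 0 : ℕ) : ℤ) := mul_left_cancel₀ hq1 (by
      rcases hs with rfl | rfl <;> linarith)
    convert ha using 1
    funext i
    fin_cases i <;> simp [ha0, ha1]
  exact ⟨fun a ha c d hc hd => weight_le_of_evalTorus_eq hp ha hc hd,
    by simpa using key0 1 (by simp), by simpa using key0 (-1) (by simp),
    by simpa using key1 1 (by simp), by simpa using key1 (-1) (by simp)⟩

end Fermi

section Average

variable {q : Fin 2 → ℕ+} {V : (Fin 2 → ℤ) → ℂ} {lam : ℂ} {p : LaurentRing}

lemma exists_wrap_antidiagonal (hq : Nat.Coprime (q 0) (q 1)) (n : Cell q) :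
    ∃ k : ℕ, n = wrap q ![(k : ℤ), -(k : ℤ)] := by
  obtain ⟨k, hk0, hk1⟩ := Nat.chineseRemainder hq (n 0 : ℕ) ((q 1 : ℕ) - (n 1 : ℕ))
  refine ⟨k, ?_⟩
  rw [← wrap_toInt n, wrap_eq_wrap]
  intro j
  fin_cases j
  · exact (Int.natCast_modEq_iff.2 hk0).symm
  · have h := (Int.natCast_modEq_iff.2 hk1).symm.neg
    rw [Nat.cast_sub (n 1).isLt.le] at h
    refine Int.ModEq.trans ?_ h
    rw [Int.modEq_iff_dvd]
    exact ⟨-1, by simp [Cell.toInt]⟩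

lemma det_eq_smul_det_updateCol {ι : Type*} [Fintype ι] [DecidableEq ι] (M : Matrix ι ι ℂ)
    (ε : ℂ) (v : ι → ℂ) (h : M.mulVec 1 = ε • v) (i : ι) :
    M.det = ε * (M.updateCol i v).det := by
  have h1 := Matrix.cramer_eq_adjugate_mulVec M (M.mulVec 1)
  rw [Matrix.mulVec_mulVec, Matrix.adjugate_mul] at h1
  have h2 := congrFun h1 i
  rw [Matrix.cramer_apply, h, Matrix.det_updateCol_smul] at h2
  simpa [Matrix.smul_mulVec] using h2.symm

/-- Amplitudes for hopping forward with opposite signs in the two directions. -/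
def antiHop (ε : ℂ) (j : Fin 2) (s : ℤ) : ℂ :=
  (if j = 0 then 1 else -1) * (if s = 1 then 1 else ε ^ 2)

lemma antiHop_mulVec_one (ε : ℂ) (v : Cell q → ℂ) :
    (hopMat (antiHop ε) (fun n => ε * v n)).mulVec 1 = ε • v := by
  funext n
  rw [hopMat_mulVec]
  simp only [antiHop, Fin.sum_univ_two, Pi.smul_apply, Pi.one_apply]
  simp
  ring

lemma continuous_antiHop (v : Cell q → ℂ) :
    Continuous fun ε => hopMat (antiHop ε) (fun n => ε * v n) := by
  refine continuous_hopMat_apply (fun j s => ?_) fun n => by fun_prop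
  unfold antiHop
  split_ifs <;> fun_prop

lemma sum_eq_zero_of_det_eq_zero (hq : Nat.Coprime (q 0) (q 1)) (v : Cell q → ℂ)
    (h : ((hopMat (antiHop 0) (fun n => 0 * v n)).updateCol (wrap q 0) v).det = 0) :
    ∑ n, v n = 0 := by
  obtain ⟨u, hu, hMu⟩ := Matrix.exists_mulVec_eq_zero_iff.2 h
  set o : Cell q := wrap q 0 with ho
  set w : Cell q → ℂ := Function.update u o 0 with hw
  have heq : ∀ n, w (hop 0 1 n) - w (hop 1 1 n) = u o * v n := by
    intro n
    have h1 := congrFun hMu n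
    have h2 : (((hopMat (antiHop 0) (fun n => 0 * v n)).updateCol o v).mulVec u) n
        = (hopMat (antiHop 0) (fun n => 0 * v n)).mulVec w n + u o * v n := by
      simp only [Matrix.mulVec, dotProduct]
      rw [← Finset.add_sum_erase _ _ (Finset.mem_univ o),
        ← Finset.add_sum_erase (a := o) (s := Finset.univ) (f := fun i =>
          hopMat (antiHop 0) (fun n => 0 * v n) n i * w i) (Finset.mem_univ o)]
      have h3 : ∀ i ∈ Finset.univ.erase o,
          (hopMat (antiHop 0) (fun n => 0 * v n)).updateCol o v n i * u i
            = hopMat (antiHop 0) (fun n => 0 * v n) n i * w i := by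
        intro i hi
        rw [Matrix.updateCol_ne (Finset.ne_of_mem_erase hi), hw,
          Function.update_of_ne (Finset.ne_of_mem_erase hi)]
      rw [Finset.sum_congr rfl h3, Matrix.updateCol_self, hw, Function.update_self]
      ring
    rw [h2, hopMat_mulVec] at h1
    simp [antiHop, Fin.sum_univ_two] at h1
    linear_combination -h1
  have hsum : u o * ∑ n, v n = 0 := by
    rw [Finset.mul_sum, ← Finset.sum_congr rfl fun n _ => heq n, Finset.sum_sub_distrib,
      sub_eq_zero]
    exact (Equiv.sum_comp (hopEquiv 0 1) w).trans (Equiv.sum_comp (hopEquiv 1 1) w).symm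
  rcases mul_eq_zero.1 hsum with h0 | h0
  · exfalso
    have hk : ∀ k : ℕ, w (wrap q ![(k : ℤ), -(k : ℤ)]) = 0 := by
      intro k
      induction k with
      | zero =>
        have : (![((0 : ℕ) : ℤ), -((0 : ℕ) : ℤ)] : Fin 2 → ℤ) = 0 := by
          funext i; fin_cases i <;> simp
        rw [this, hw, ho, Function.update_self]
      | succ k ih =>
        have h1 := heq (wrap q ![(k : ℤ), -(k : ℤ) - 1])
        rw [h0, zero_mul, sub_eq_zero, hop_wrap, hop_wrap] at h1
        convert h1 using 3
        · funext i; fin_cases i <;> simp; ring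
        · rw [← ih]
          congr 2
          funext i; fin_cases i <;> simp
    apply hu
    have hw0 : w = 0 := by
      funext n
      obtain ⟨k, rfl⟩ := exists_wrap_antidiagonal hq n
      exact hk k
    rw [← Function.update_eq_self o u, h0]
    exact hw0
  · exact h0

lemma eq_avgPot_of_isDiamondCorner (hq : Nat.Coprime (q 0) (q 1))
    (hp : ∀ z : Fin 2 → ℂˣ, scriptP q V (fun j => z j) lam = evalTorus z p)
    (hcor : ∀ a ∈ p.coeff.support, IsDiamondCorner (q 0) (q 1) a) : lam = avgPot q V := by
  set N : ℕ := (q 0 : ℕ) * q 1 with hN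
  have hN0 : 0 < N := Nat.mul_pos (q 0).pos (q 1).pos
  set v : Cell q → ℂ := fun n => V n.toInt - lam with hv
  set M : ℂ → Matrix (Cell q) (Cell q) ℂ := fun ε =>
    hopMat (antiHop ε) (fun n => ε * v n) with hM
  have hdet : ∀ ε, (M ε).det = ε * ((M ε).updateCol (wrap q 0) v).det := fun ε =>
    det_eq_smul_det_updateCol _ _ _ (antiHop_mulVec_one ε v) _
  obtain ⟨A, B, hAB⟩ : ∃ A B : ℂ, ∀ ε, ε ≠ 0 → (M ε).det = A + B * ε ^ (2 * N) := by
    have hterm : ∀ a, IsDiamondCorner (q 0) (q 1) a → ∃ A B : ℂ, ∀ (ε : ℂ), ε ≠ 0 →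
        ε ^ N * ((ε⁻¹ ^ (q 0 : ℕ)) ^ a 0 * ((-ε⁻¹) ^ (q 1 : ℕ)) ^ a 1) = A + B * ε ^ (2 * N) := by
      intro a ha
      have hrw : ∀ ε : ℂ, ε ≠ 0 →
          ε ^ N * ((ε⁻¹ ^ (q 0 : ℕ)) ^ a 0 * ((-ε⁻¹) ^ (q 1 : ℕ)) ^ a 1)
            = ((-1) ^ (q 1 : ℕ)) ^ a 1 * ε ^ ((N : ℤ) - diagWeight (q 0) (q 1) 1 1 a) := by
        intro ε hε
        rw [neg_pow, mul_zpow, inv_pow, inv_pow, inv_zpow', inv_zpow', ← zpow_natCast ε (q 0 : ℕ),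
          ← zpow_natCast ε (q 1 : ℕ), ← zpow_mul, ← zpow_mul, ← zpow_natCast ε N,
          diagWeight_apply, zpow_sub₀ hε, one_mul, one_mul, zpow_add₀ hε, mul_neg, mul_neg,
          zpow_neg, zpow_neg]
        field_simp
      rcases ha.1 with h | h
      · refine ⟨((-1) ^ (q 1 : ℕ)) ^ a 1, 0, fun ε hε => ?_⟩
        rw [hrw ε hε, h, hN]
        simp
      · refine ⟨0, ((-1) ^ (q 1 : ℕ)) ^ a 1, fun ε hε => ?_⟩
        rw [hrw ε hε, h, zero_add, ← zpow_natCast ε (2 * N)]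
        congr 2
        rw [hN]
        push_cast
        ring
    choose! A B hAB using hterm
    refine ⟨∑ a ∈ p.coeff.support, p.coeff a * A a, ∑ a ∈ p.coeff.support, p.coeff a * B a,
      fun ε hε => ?_⟩
    set ζ : Fin 2 → ℂˣ := ![(Units.mk0 ε hε)⁻¹, -(Units.mk0 ε hε)⁻¹] with hζ
    have h1 := scriptP_torusPow (q := q) V lam ζ
    rw [hp] at h1
    have h2 : M ε = ε • hopMat (fun j s => (ζ j : ℂ) ^ s) v := by
      rw [smul_hopMat, hM]
      apply hopMat_congr
      · intro j
        fin_cases j <;> simp [antiHop, hζ, hε]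
      · intro j
        fin_cases j <;> simp [antiHop, hζ, sq, inv_neg]
    rw [h2, Matrix.det_smul, ← h1, card_cell, ← hN, evalTorus_apply, Finsupp.sum,
      Finset.mul_sum, Finset.sum_mul, ← Finset.sum_add_distrib]
    refine Finset.sum_congr rfl fun a ha => ?_
    have h3 : ∏ j, (torusPow q ζ j : ℂ) ^ a j
        = (ε⁻¹ ^ (q 0 : ℕ)) ^ a 0 * ((-ε⁻¹) ^ (q 1 : ℕ)) ^ a 1 := by
      simp [Fin.prod_univ_two, torusPow, hζ]
    rw [h3]
    linear_combination p.coeff a * hAB a (hcor a ha) ε hε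
  have hMc : Continuous M := continuous_antiHop v
  have hA : A = 0 := by
    have := eq_of_eqOn_ne_zero hMc.matrix_det (by fun_prop) hAB
    rw [hdet 0, zero_mul, zero_pow (by omega), mul_zero, add_zero] at this
    exact this.symm
  have hB : ∀ ε, ε ≠ 0 → ((M ε).updateCol (wrap q 0) v).det = B * ε ^ (2 * N - 1) := by
    intro ε hε
    have h1 := hAB ε hε
    rw [hdet, hA, zero_add] at h1
    apply mul_left_cancel₀ hε
    rw [h1, mul_left_comm ε B, mul_pow_sub_one (by omega)]
  have h0 := eq_of_eqOn_ne_zero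
    (hMc.matrix_updateCol (wrap q 0) continuous_const).matrix_det (by fun_prop) hB
  rw [zero_pow (by omega), mul_zero] at h0
  have hs := sum_eq_zero_of_det_eq_zero hq v h0
  rw [hv, Finset.sum_sub_distrib, Finset.sum_const, Finset.card_univ, card_cell, ← hN,
    nsmul_eq_mul, sub_eq_zero] at hs
  have hNC : (N : ℂ) ≠ 0 := by exact_mod_cast hN0.ne'
  rw [avgPot, Fin.prod_univ_two, ← hN]
  change lam = 1 / (N : ℂ) * ∑ n : Cell q, V n.toInt
  rw [hs]
  field_simp

end Average

section Factorization

lemma not_single_of_not_isMonomial {f : (Fin 2 → ℂ) → ℂ} {p : LaurentRing}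
    (hf : ∀ z : Fin 2 → ℂˣ, f (fun j => z j) = evalTorus z p) (hm : ¬ IsMonomial f) :
    ¬ ∃ a C, C ≠ 0 ∧ p = AddMonoidAlgebra.single a C := by
  rintro ⟨a, C, hC, rfl⟩
  refine hm ⟨C, a, hC, fun z hz => ?_⟩
  exact (hf fun j => Units.mk0 (z j) (hz j)).trans (evalTorus_single _ a C)

variable {q : Fin 2 → ℕ+} {V : (Fin 2 → ℤ) → ℂ} {lam : ℂ}

/-- A factorization of `𝒫_V(·, λ)` into functions lifts to the Laurent polynomial ring. -/
lemma exists_prod_evalTorus {k : ℕ} (F : Fin k → (Fin 2 → ℂ) → ℂ)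
    (hF : ∀ i, IsLaurent (F i) ∧ ¬ IsMonomial (F i))
    (h : ∀ z : Fin 2 → ℂ, (∀ j, z j ≠ 0) → scriptP q V z lam = ∏ i, F i z) :
    ∃ G : Fin k → LaurentRing, (∀ i, ¬ ∃ a C, C ≠ 0 ∧ G i = AddMonoidAlgebra.single a C) ∧
      ∀ z : Fin 2 → ℂˣ, scriptP q V (fun j => z j) lam = evalTorus z (∏ i, G i) := by
  choose G hG using fun i => (hF i).1.exists_evalTorus
  refine ⟨G, fun i => not_single_of_not_isMonomial (hG i) (hF i).2, fun z => ?_⟩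
  rw [h _ fun j => (z j).ne_zero, map_prod]
  exact Finset.prod_congr rfl fun i _ => hG i z

lemma length_le_two_of_factorization (hq : Nat.Coprime (q 0) (q 1)) {k : ℕ}
    (F : Fin k → (Fin 2 → ℂ) → ℂ) (hF : ∀ i, IsLaurent (F i) ∧ ¬ IsMonomial (F i))
    (h : ∀ z : Fin 2 → ℂ, (∀ j, z j ≠ 0) → scriptP q V z lam = ∏ i, F i z) : k ≤ 2 := by
  obtain ⟨G, hG, hP⟩ := exists_prod_evalTorus F hF h
  exact (hasDiamond_of_evalTorus_eq hP).card_le_two (q 0).pos (q 1).pos hq G hG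

lemma length_ne_zero_of_factorization {k : ℕ} (F : Fin k → (Fin 2 → ℂ) → ℂ)
    (hF : ∀ i, IsLaurent (F i) ∧ ¬ IsMonomial (F i))
    (h : ∀ z : Fin 2 → ℂ, (∀ j, z j ≠ 0) → scriptP q V z lam = ∏ i, F i z) : k ≠ 0 := by
  rintro rfl
  obtain ⟨G, -, hP⟩ := exists_prod_evalTorus F hF h
  obtain ⟨a, ha, hqa⟩ := exists_mem_support_eq hP 0 (Or.inl rfl)
  rw [Finset.univ_eq_empty, Finset.prod_empty, AddMonoidAlgebra.one_def,
    AddMonoidAlgebra.coeff_single] at ha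
  rw [Finset.mem_singleton.1 (Finsupp.support_single_subset ha)] at hqa
  simp at hqa

lemma eq_avgPot_of_factorization (hq : Nat.Coprime (q 0) (q 1))
    (h : ¬ LaurentIrreducible fun z => scriptP q V z lam) : lam = avgPot q V := by
  obtain ⟨f, g, hf, hg, hf', hg', hfg⟩ := not_not.1 h
  obtain ⟨a, ha⟩ := hf.exists_evalTorus
  obtain ⟨b, hb⟩ := hg.exists_evalTorus
  have hP : ∀ z : Fin 2 → ℂˣ, scriptP q V (fun j => z j) lam = evalTorus z (a * b) := by
    intro z
    rw [map_mul, ← ha, ← hb]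
    exact hfg _ fun j => (z j).ne_zero
  exact eq_avgPot_of_isDiamondCorner hq hP fun x hx =>
    (hasDiamond_of_evalTorus_eq hP).isCorner (q 0).pos (q 1).pos hq
      (not_single_of_not_isMonomial ha hf') (not_single_of_not_isMonomial hb hg') hx

lemma laurentIrreducible_left_of_factorization (hq : Nat.Coprime (q 0) (q 1))
    {f g : (Fin 2 → ℂ) → ℂ} (hg : IsLaurent g) (hg' : ¬ IsMonomial g)
    (h : ∀ z : Fin 2 → ℂ, (∀ j, z j ≠ 0) → scriptP q V z lam = f z * g z) :
    LaurentIrreducible f := by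
  rintro ⟨f₁, f₂, h1, h2, h1', h2', hf⟩
  have := length_le_two_of_factorization (lam := lam) (V := V) hq ![f₁, f₂, g]
    (by intro i; fin_cases i <;> simp [*])
    (fun z hz => by simp [Fin.prod_univ_three, h z hz, hf z hz])
  omega

end Factorization

/-- Let `d = 2` and `V : ℤ² → ℂ` be `Γ`-periodic.  Then for every
`λ ≠ [V]` the Laurent polynomial `z ↦ 𝒫_V(z, λ)` is irreducible; moreover, if
`𝒫_V(z, [V])` is reducible, then it has exactly two non-monomial irreducible
factors, counted with multiplicity. -/
theorem statement3 (q : Fin 2 → ℕ+)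
    (hq : ∀ i j, i ≠ j → Nat.Coprime (q i) (q j))
    (V : (Fin 2 → ℤ) → ℂ) (hV : IsPeriodic q V) :
    (∀ lam : ℂ, lam ≠ avgPot q V → LaurentIrreducible (fun z => scriptP q V z lam)) ∧
    (¬ LaurentIrreducible (fun z => scriptP q V z (avgPot q V)) →
      -- a factorization into exactly two non-monomial irreducible factors exists
      (∃ f g : (Fin 2 → ℂ) → ℂ,
        IsLaurent f ∧ IsLaurent g ∧ ¬ IsMonomial f ∧ ¬ IsMonomial g ∧
        LaurentIrreducible f ∧ LaurentIrreducible g ∧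
        ∀ z : Fin 2 → ℂ, (∀ j, z j ≠ 0) → scriptP q V z (avgPot q V) = f z * g z) ∧
      -- and any factorization into non-monomial irreducible factors has exactly two factors
      (∀ (m : ℕ) (F : Fin m → ((Fin 2 → ℂ) → ℂ)),
        (∀ i, IsLaurent (F i) ∧ ¬ IsMonomial (F i) ∧ LaurentIrreducible (F i)) →
        (∀ z : Fin 2 → ℂ, (∀ j, z j ≠ 0) → scriptP q V z (avgPot q V) = ∏ i, F i z) →
        m = 2)) := by
  have hq01 : Nat.Coprime (q 0) (q 1) := hq 0 1 (by decide)
  refine ⟨fun lam hlam => by_contra fun h => hlam (eq_avgPot_of_factorization hq01 h),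
    fun hred => ⟨?_, fun m F hF hprod => ?_⟩⟩
  · obtain ⟨f, g, hf, hg, hf', hg', hfg⟩ := not_not.1 hred
    exact ⟨f, g, hf, hg, hf', hg',
      laurentIrreducible_left_of_factorization hq01 hg hg' hfg,
      laurentIrreducible_left_of_factorization hq01 hf hf'
        fun z hz => (hfg z hz).trans (mul_comm _ _), hfg⟩
  · have hF' : ∀ i, IsLaurent (F i) ∧ ¬ IsMonomial (F i) := fun i => ⟨(hF i).1, (hF i).2.1⟩
    have hle := length_le_two_of_factorization hq01 F hF' hprod
    have hne := length_ne_zero_of_factorization F hF' hprod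
    have h1 : m ≠ 1 := by
      rintro rfl
      obtain ⟨f, g, hf, hg, hf', hg', hfg⟩ := not_not.1 hred
      refine (hF 0).2.2 ⟨f, g, hf, hg, hf', hg', fun z hz => ?_⟩
      exact ((hprod z hz).trans (Fin.prod_univ_one _)).symm.trans (hfg z hz)
    omega

end
end
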